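/- arXiv:1901.10347 — 2 statements merged into one kernel-verified Lean document; each statement's English description precedes it below -/
import Mathlib

section
/- Let α be any symmetric a priori probability measure on {-1,0,1} (i.e., α(1) = α(−1) > 0 and α(0) > 0), let β > 0 and t > 0. Then the set of bad empirical measures of the time-evolved mean-field soft-core Widom-Rowlinson model satisfies B^{WiRo}(β,t) = { ν ∈ M₁({-1,0,1}) : ν(1) + ν(−1) > 0 and (ν(1) − ν(−1))/(ν(1) + ν(−1)) ∈ B^{Ising}( β(ν(1) + ν(−1))/2, t ) }, where B^{Ising}(β_I, t) denotes the set of bad magnetizations of the time-evolved Curie-Weiss Ising model with initial inverse temperature β_I. In particular B^{WiRo}(β,t) does not depend on the choice of the symmetric a priori measure α. -/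
open Real Filter Finset Topology

/-- The local state space `{-1, 0, 1}` of the Widom-Rowlinson model. -/
abbrev Spin : Finset ℤ := {-1, 0, 1}

/-- A probability vector on `{-1, 0, 1}`, encoded as a function `ℤ → ℝ`
supported on `{-1, 0, 1}`. -/
def IsProbVec (ν : ℤ → ℝ) : Prop :=
  (∀ s, 0 ≤ ν s) ∧ (∀ s, s ∉ Spin → ν s = 0) ∧ ∑ s ∈ Spin, ν s = 1

/-- The (unnormalized) Boltzmann weight of the mean-field soft-core Widom-Rowlinson
model with repulsion parameter `β` and a priori measure `α`, at system size `N`. -/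
noncomputable def wrWeight (β : ℝ) (α : ℤ → ℝ) {N : ℕ} (ω : Fin N → Spin) : ℝ :=
  Real.exp (-(β / (2 * (N : ℝ))) * ∑ i : Fin N, ∑ j : Fin N,
      (if ((ω i : ℤ) * (ω j : ℤ) = -1) then (1 : ℝ) else 0))
    * ∏ j : Fin N, α (ω j : ℤ)

/-- Transition probabilities of the rate-one independent symmetric spin-flip
dynamics which keeps holes fixed. -/
noncomputable def pFlip (t : ℝ) (a b : ℤ) : ℝ :=
  if a = 0 ∧ b = 0 then 1
  else if (a = 1 ∧ b = 1) ∨ (a = -1 ∧ b = -1) then (1 + Real.exp (-2 * t)) / 2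
  else if (a = 1 ∧ b = -1) ∨ (a = -1 ∧ b = 1) then (1 - Real.exp (-2 * t)) / 2
  else 0

/-- The (unnormalized) weight of the time-evolved mean-field soft-core
Widom-Rowlinson model at time `t`. -/
noncomputable def wrWeightT (β : ℝ) (α : ℤ → ℝ) (t : ℝ) {N : ℕ}
    (η : Fin N → Spin) : ℝ :=
  ∑ ω : Fin N → Spin, wrWeight β α ω * ∏ i : Fin N, pFlip t (ω i : ℤ) (η i : ℤ)

/-- The single-site conditional probability `μ_{N+1,t}(η_1 = σ | rest = τ)` of the
time-evolved mean-field soft-core Widom-Rowlinson model. -/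
noncomputable def wrCondProbT (β : ℝ) (α : ℤ → ℝ) (t : ℝ) {N : ℕ} (σ : Spin)
    (τ : Fin N → Spin) : ℝ :=
  wrWeightT β α t (Fin.cons σ τ) / ∑ σ' : Spin, wrWeightT β α t (Fin.cons σ' τ)

/-- The empirical distributions of the boundary conditions `τ N` converge to `ν`. -/
def EmpConv (τ : (N : ℕ) → Fin N → Spin) (ν : ℤ → ℝ) : Prop :=
  ∀ s : ℤ, Tendsto
    (fun N : ℕ => ((univ.filter (fun i : Fin N => (τ N i : ℤ) = s)).card : ℝ) / N)
    atTop (𝓝 (ν s))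

/-- `ν` is a bad empirical measure for the time-evolved mean-field soft-core
Widom-Rowlinson model at time `t`: there are two sequences of boundary conditions,
both with empirical distributions converging to `ν`, along which some single-site
conditional probability does not converge to the same limit. -/
def IsBadMeasure (β : ℝ) (α : ℤ → ℝ) (t : ℝ) (ν : ℤ → ℝ) : Prop :=
  ∃ τ τ' : (N : ℕ) → Fin N → Spin, EmpConv τ ν ∧ EmpConv τ' ν ∧
    ∃ σ : Spin, ¬ ∃ L : ℝ,
      Tendsto (fun N : ℕ => wrCondProbT β α t σ (τ N)) atTop (𝓝 L) ∧
      Tendsto (fun N : ℕ => wrCondProbT β α t σ (τ' N)) atTop (𝓝 L)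

/-- The Ising local state space `{-1, 1}`. -/
abbrev ISpin : Finset ℤ := {-1, 1}

/-- The (unnormalized) weight of the time-evolved Curie-Weiss Ising model at inverse
temperature `βI` after time `t` of rate-one independent symmetric spin-flip. -/
noncomputable def isingWeightT (βI t : ℝ) {N : ℕ} (η : Fin N → ISpin) : ℝ :=
  ∑ σ : Fin N → ISpin,
    Real.exp (βI / (2 * (N : ℝ)) * (∑ i : Fin N, ((σ i : ℤ) : ℝ)) ^ 2) *
      (2 : ℝ) ^ (-(N : ℤ)) * ∏ i : Fin N, pFlip t (σ i : ℤ) (η i : ℤ)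

/-- The single-site conditional probability `μ^I_{N+1,t}(η_1 = σ | rest = τ)` of the
time-evolved Curie-Weiss Ising model. -/
noncomputable def isingCondProbT (βI t : ℝ) {N : ℕ} (σ : ISpin)
    (τ : Fin N → ISpin) : ℝ :=
  isingWeightT βI t (Fin.cons σ τ) / ∑ σ' : ISpin, isingWeightT βI t (Fin.cons σ' τ)

/-- `m` is a bad magnetization for the time-evolved Curie-Weiss Ising model with
initial inverse temperature `βI` at time `t`: there are two sequences of boundary
conditions, both with empirical magnetizations converging to `m`, along which some
single-site conditional probability does not converge to the same limit. -/
def IsBadMagnetization (βI t : ℝ) (m : ℝ) : Prop :=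
  ∃ τ τ' : (N : ℕ) → Fin N → ISpin,
    Tendsto (fun N : ℕ => (∑ i : Fin N, ((τ N i : ℤ) : ℝ)) / N) atTop (𝓝 m) ∧
    Tendsto (fun N : ℕ => (∑ i : Fin N, ((τ' N i : ℤ) : ℝ)) / N) atTop (𝓝 m) ∧
    ∃ σ : ISpin, ¬ ∃ L : ℝ,
      Tendsto (fun N : ℕ => isingCondProbT βI t σ (τ N)) atTop (𝓝 L) ∧
      Tendsto (fun N : ℕ => isingCondProbT βI t σ (τ' N)) atTop (𝓝 L)

/-! ### The field representation: generating functions of a flipped spin -/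

/-- Moment generating function of a `±1`-valued spin with weights `a` at `+1`, `b` at `-1`. -/
noncomputable def spinGen (a b x : ℝ) : ℝ := a * exp x + b * exp (-x)

/-- The limiting exponential rate of the field density. -/
noncomputable def fieldRate (a b c p q x : ℝ) : ℝ :=
  -c * x ^ 2 + p * log (spinGen a b x) + q * log (spinGen b a x)

/-- Integral of `h` against the unnormalized field density at system size `M`, for a boundary
condition with `k` plus spins and `l` minus spins. -/
noncomputable def fieldIntegral (a b c M : ℝ) (k l : ℕ) (h : ℝ → ℝ) : ℝ :=
  ∫ x, exp (-(c * M) * x ^ 2) * spinGen a b x ^ k * spinGen b a x ^ l * h x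

/-- `x` is a global maximizer of `φ`. -/
def IsGlobalMax (φ : ℝ → ℝ) (x : ℝ) : Prop := ∀ y, φ y ≤ φ x

/-- `φ` has at most one global maximizer. -/
def UniqueGlobalMax (φ : ℝ → ℝ) : Prop := ∀ x y, IsGlobalMax φ x → IsGlobalMax φ y → x = y

lemma spinGen_pos {a b : ℝ} (ha : 0 < a) (hb : 0 < b) (x : ℝ) : 0 < spinGen a b x := by
  unfold spinGen; positivity

lemma continuous_spinGen (a b : ℝ) : Continuous (spinGen a b) := by
  unfold spinGen; fun_prop

lemma spinGen_neg (a b x : ℝ) : spinGen a b (-x) = spinGen b a x := by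
  simp [spinGen, add_comm]

lemma spinGen_le_exp_abs {a b : ℝ} (ha : 0 < a) (hb : 0 < b) (hab : a + b = 1) (x : ℝ) :
    spinGen a b x ≤ exp |x| := by
  have h1 : exp x ≤ exp |x| := exp_le_exp.2 (le_abs_self x)
  have h2 : exp (-x) ≤ exp |x| := exp_le_exp.2 (neg_le_abs x)
  unfold spinGen
  calc _ ≤ a * exp |x| + b * exp |x| := by gcongr
    _ = exp |x| := by rw [← add_mul, hab, one_mul]

lemma abs_log_spinGen_le {a b : ℝ} (ha : 0 < a) (hb : 0 < b) (hab : a + b = 1) (x : ℝ) :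
    |log (spinGen a b x)| ≤ |x| := by
  have hp := spinGen_pos ha hb x
  rw [abs_le]
  constructor
  · rw [le_log_iff_exp_le hp]
    have h1 : exp (-|x|) ≤ exp x := exp_le_exp.2 (neg_abs_le x)
    have h2 : exp (-|x|) ≤ exp (-x) := exp_le_exp.2 (neg_le_neg (le_abs_self x))
    unfold spinGen
    calc exp (-|x|) = a * exp (-|x|) + b * exp (-|x|) := by rw [← add_mul, hab, one_mul]
      _ ≤ _ := by gcongr
  · rw [log_le_iff_le_exp hp]
    exact spinGen_le_exp_abs ha hb hab x

lemma spinGen_mul_lt {a b : ℝ} (hb : 0 < b) (hba : b < a) {x y : ℝ} (hxy : x < y) :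
    spinGen a b x * spinGen b a y < spinGen a b y * spinGen b a x := by
  have h : exp (x - y) < exp (y - x) := exp_lt_exp.2 (by linarith)
  have key : spinGen a b y * spinGen b a x - spinGen a b x * spinGen b a y
      = (a ^ 2 - b ^ 2) * (exp (y - x) - exp (x - y)) := by
    simp only [spinGen, sub_eq_add_neg, exp_add]; ring
  have : 0 < (a ^ 2 - b ^ 2) * (exp (y - x) - exp (x - y)) :=
    mul_pos (by nlinarith) (by linarith)
  linarith

lemma continuous_fieldRate {a b : ℝ} (ha : 0 < a) (hb : 0 < b) (c p q : ℝ) :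
    Continuous (fieldRate a b c p q) := by
  have h1 : Continuous fun x => log (spinGen a b x) :=
    (continuous_spinGen a b).log fun x => (spinGen_pos ha hb x).ne'
  have h2 : Continuous fun x => log (spinGen b a x) :=
    (continuous_spinGen b a).log fun x => (spinGen_pos hb ha x).ne'
  unfold fieldRate; fun_prop

lemma abs_fieldRate_sub_le {a b : ℝ} (ha : 0 < a) (hb : 0 < b) (hab : a + b = 1)
    (c p q p' q' x : ℝ) :
    |fieldRate a b c p' q' x - fieldRate a b c p q x| ≤ (|p' - p| + |q' - q|) * |x| := by
  have h1 := abs_log_spinGen_le ha hb hab x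
  have h2 := abs_log_spinGen_le hb ha (by linarith) x
  have : fieldRate a b c p' q' x - fieldRate a b c p q x =
      (p' - p) * log (spinGen a b x) + (q' - q) * log (spinGen b a x) := by
    unfold fieldRate; ring
  rw [this]
  calc _ ≤ |(p' - p) * log (spinGen a b x)| + |(q' - q) * log (spinGen b a x)| := abs_add_le _ _
    _ = |p' - p| * |log (spinGen a b x)| + |q' - q| * |log (spinGen b a x)| := by
      rw [abs_mul, abs_mul]
    _ ≤ |p' - p| * |x| + |q' - q| * |x| := by gcongr
    _ = _ := by ring

lemma fieldRate_le {a b : ℝ} (ha : 0 < a) (hb : 0 < b) (hab : a + b = 1) (c p q x : ℝ) :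
    fieldRate a b c p q x ≤ -c * x ^ 2 + (|p| + |q|) * |x| := by
  have h := (abs_le.1 (abs_fieldRate_sub_le ha hb hab c 0 0 p q x)).2
  have h0 : fieldRate a b c 0 0 x = -c * x ^ 2 := by simp [fieldRate]
  rw [h0] at h
  simp only [sub_zero] at h
  linarith

/-- Quadratic upper bound for the rate far away from the origin. -/
lemma exists_fieldRate_le {a b c : ℝ} (ha : 0 < a) (hb : 0 < b) (hab : a + b = 1) (hc : 0 < c)
    (p q s : ℝ) :
    ∃ R : ℝ, 0 < R ∧ ∀ x, R ≤ |x| → fieldRate a b c p q x ≤ s - c / 2 * (1 + x ^ 2) := by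
  set B := |p| + |q|
  have hB : 0 ≤ B := by positivity
  refine ⟨1 + 2 * (B + |s| + c) / c, by positivity, fun x hx => ?_⟩
  have h := fieldRate_le ha hb hab c p q x
  have hx1 : 1 ≤ |x| := le_trans (by simp; positivity) hx
  have hx2 : 2 * (B + |s| + c) ≤ c * |x| := by
    have : 2 * (B + |s| + c) / c ≤ |x| := by linarith
    rw [div_le_iff₀ hc] at this; linarith
  have hsq : x ^ 2 = |x| ^ 2 := (sq_abs x).symm
  have hs := neg_abs_le s
  have h3 : 2 * (B + |s| + c) * |x| ≤ c * |x| * |x| := by gcongr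
  have h4 : |s| + c ≤ (|s| + c) * |x| := le_mul_of_one_le_right (by positivity) hx1
  rw [hsq] at h ⊢
  nlinarith

lemma exists_isGlobalMax_fieldRate {a b c : ℝ} (ha : 0 < a) (hb : 0 < b) (hab : a + b = 1)
    (hc : 0 < c) (p q : ℝ) : ∃ x, IsGlobalMax (fieldRate a b c p q) x := by
  obtain ⟨R, hR, h⟩ := exists_fieldRate_le ha hb hab hc p q (fieldRate a b c p q 0)
  refine (continuous_fieldRate ha hb c p q).exists_forall_ge' (x₀ := 0) ?_
  rw [← Metric.cobounded_eq_cocompact]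
  filter_upwards [tendsto_norm_cobounded_atTop.eventually_ge_atTop R] with x hx
  refine (h x hx).trans ?_
  have : 0 ≤ c / 2 * (1 + x ^ 2) := by positivity
  linarith

/-- Away from the maximizers, the rate stays below its maximum by a quadratic margin. -/
lemma exists_fieldRate_gap {a b c : ℝ} (ha : 0 < a) (hb : 0 < b) (hab : a + b = 1) (hc : 0 < c)
    (p q : ℝ) {h : ℝ → ℝ} (hh : Continuous h)
    (hpos : ∀ x, IsGlobalMax (fieldRate a b c p q) x → 0 < h x)
    {x₀ : ℝ} (hx₀ : IsGlobalMax (fieldRate a b c p q) x₀) :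
    ∃ δ : ℝ, 0 < δ ∧ ∀ x, h x ≤ 0 →
      fieldRate a b c p q x ≤ fieldRate a b c p q x₀ - δ * (1 + x ^ 2) := by
  set φ := fieldRate a b c p q with hφ
  obtain ⟨R, hR, hfar⟩ := exists_fieldRate_le ha hb hab hc p q (φ x₀)
  have hcomp : IsCompact (Set.Icc (-R) R ∩ {x | h x ≤ 0}) :=
    isCompact_Icc.inter_right (isClosed_le hh continuous_const)
  have hφc : Continuous φ := continuous_fieldRate ha hb c p q
  obtain ⟨η, hη, hnear⟩ : ∃ η : ℝ, 0 < η ∧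
      ∀ x ∈ Set.Icc (-R) R ∩ {x | h x ≤ 0}, φ x ≤ φ x₀ - η := by
    rcases (Set.Icc (-R) R ∩ {x | h x ≤ 0}).eq_empty_or_nonempty with he | hne
    · exact ⟨1, one_pos, by simp [he]⟩
    · obtain ⟨y, hy, hmax⟩ := hcomp.exists_isMaxOn hne hφc.continuousOn
      have hlt : φ y < φ x₀ := by
        by_contra hcon
        have : IsGlobalMax φ y := fun z => (hx₀ z).trans (not_lt.1 hcon)
        exact absurd (hpos y this) (not_lt.2 hy.2)
      exact ⟨φ x₀ - φ y, by linarith, fun x hx => by have := hmax hx; simp at this; linarith⟩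
  refine ⟨min (c / 2) (η / (1 + R ^ 2)), lt_min (by positivity) (by positivity), fun x hx => ?_⟩
  rcases le_total R |x| with hxR | hxR
  · refine (hfar x hxR).trans ?_
    gcongr
    exact min_le_left _ _
  · refine (hnear x ⟨abs_le.1 hxR, hx⟩).trans ?_
    have h1 : x ^ 2 ≤ R ^ 2 := by rw [← sq_abs x]; gcongr
    have h2 : min (c / 2) (η / (1 + R ^ 2)) * (1 + x ^ 2) ≤ η / (1 + R ^ 2) * (1 + R ^ 2) := by
      gcongr
      exact min_le_right _ _
    rw [div_mul_cancel₀ _ (by positivity)] at h2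
    linarith

/-! ### Gaussian integrals -/

lemma exp_quadratic_eq {A : ℝ} (hA : 0 < A) (s x : ℝ) :
    exp (-A * x ^ 2) * exp (x * s) =
      exp (s ^ 2 / (4 * A)) * exp (-A * (x - s / (2 * A)) ^ 2) := by
  rw [← exp_add, ← exp_add]; congr 1; field_simp; ring

lemma integrable_exp_quadratic {A : ℝ} (hA : 0 < A) (s : ℝ) :
    MeasureTheory.Integrable fun x : ℝ => exp (-A * x ^ 2) * exp (x * s) := by
  simp_rw [exp_quadratic_eq hA]
  exact ((integrable_exp_neg_mul_sq hA).comp_sub_right _).const_mul _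

lemma integral_exp_quadratic {A : ℝ} (hA : 0 < A) (s : ℝ) :
    ∫ x : ℝ, exp (-A * x ^ 2) * exp (x * s) = √(π / A) * exp (s ^ 2 / (4 * A)) := by
  simp_rw [exp_quadratic_eq hA]
  rw [MeasureTheory.integral_const_mul,
    MeasureTheory.integral_sub_right_eq_self (fun x => exp (-A * x ^ 2)), integral_gaussian,
    mul_comm]

lemma integrable_exp_quadratic_abs {A : ℝ} (hA : 0 < A) (s : ℝ) :
    MeasureTheory.Integrable fun x : ℝ => exp (-A * x ^ 2) * exp (s * |x|) := by
  refine ((integrable_exp_quadratic hA s).add (integrable_exp_quadratic hA (-s))).mono'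
    (by fun_prop) (MeasureTheory.ae_of_all _ fun x => ?_)
  rw [norm_of_nonneg (by positivity)]
  simp only [Pi.add_apply]
  rw [← mul_add]
  gcongr
  rcases abs_cases x with ⟨h, -⟩ | ⟨h, -⟩ <;> rw [h]
  · rw [mul_comm s x]; linarith [exp_pos (x * -s)]
  · rw [show s * -x = x * -s by ring]; linarith [exp_pos (x * s)]

lemma integrable_fieldDensity_mul {a b c M C : ℝ} (ha : 0 < a) (hb : 0 < b) (hab : a + b = 1)
    (hc : 0 < c) (hM : 0 < M) (k l : ℕ) {h : ℝ → ℝ} (hh : Continuous h)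
    (hC : ∀ x, |h x| ≤ C * exp |x|) :
    MeasureTheory.Integrable fun x =>
      exp (-(c * M) * x ^ 2) * spinGen a b x ^ k * spinGen b a x ^ l * h x := by
  have h1 := continuous_spinGen a b
  have h2 := continuous_spinGen b a
  refine ((integrable_exp_quadratic_abs (mul_pos hc hM)
    ((k : ℝ) + l + 1)).const_mul C).mono'
    (by fun_prop) (MeasureTheory.ae_of_all _ fun x => ?_)
  have p1 := spinGen_pos ha hb x
  have p2 := spinGen_pos hb ha x
  rw [norm_mul, norm_of_nonneg (by positivity), norm_eq_abs]
  have e : C * (exp (-(c * M) * x ^ 2) * exp (((k : ℝ) + l + 1) * |x|)) =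
      exp (-(c * M) * x ^ 2) * exp |x| ^ k * exp |x| ^ l * (C * exp |x|) := by
    rw [add_mul, add_mul, exp_add, exp_add, exp_nat_mul, exp_nat_mul, one_mul]; ring
  rw [e]
  have := hC x
  gcongr
  · exact spinGen_le_exp_abs ha hb hab x
  · exact spinGen_le_exp_abs hb ha (by linarith) x

lemma fieldDensity_eq_exp {a b M : ℝ} (ha : 0 < a) (hb : 0 < b) (hM : 0 < M) (c : ℝ)
    (k l : ℕ) (x : ℝ) :
    exp (-(c * M) * x ^ 2) * spinGen a b x ^ k * spinGen b a x ^ l =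
      exp (M * fieldRate a b c (k / M) (l / M) x) := by
  have p1 := spinGen_pos ha hb x
  have p2 := spinGen_pos hb ha x
  have e : M * fieldRate a b c (k / M) (l / M) x =
      -(c * M) * x ^ 2 + k * log (spinGen a b x) + l * log (spinGen b a x) := by
    unfold fieldRate; field_simp
  rw [e, exp_add, exp_add, exp_nat_mul, exp_nat_mul, exp_log p1, exp_log p2]

/-! ### Concentration of the field density -/

lemma fieldDensity_mul_ge {a b c p q : ℝ} (ha : 0 < a) (hb : 0 < b) (hab : a + b = 1)
    {h : ℝ → ℝ} {C : ℝ} (hC : ∀ x, |h x| ≤ C * exp |x|) {x₀ r δ δ₀ : ℝ} (hδ₀ : 0 < δ₀)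
    (hnear : ∀ x ∈ Set.Icc (x₀ - r) (x₀ + r), δ₀ ≤ h x ∧
      fieldRate a b c p q x₀ - δ / 4 ≤ fieldRate a b c p q x)
    (hgap : ∀ x, h x ≤ 0 →
      fieldRate a b c p q x ≤ fieldRate a b c p q x₀ - δ * (1 + x ^ 2))
    {M : ℝ} {k l : ℕ} (hM : 2 ≤ M * δ)
    (hM0 : 0 < M) (hε : |k / M - p| + |l / M - q| ≤ δ / 2)
    (hε' : (|k / M - p| + |l / M - q|) * (|x₀| + r) ≤ δ / 4) (x : ℝ) :
    (Set.Icc (x₀ - r) (x₀ + r)).indicator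
        (fun _ => δ₀ * exp (M * (fieldRate a b c p q x₀ - δ / 2))) x
      - C * exp (M * (fieldRate a b c p q x₀ - 3 * δ / 4) + 1 / 2) * exp (-1 * x ^ 2) ≤
    exp (-(c * M) * x ^ 2) * spinGen a b x ^ k * spinGen b a x ^ l * h x := by
  rw [fieldDensity_eq_exp ha hb hM0]
  set φ := fieldRate a b c p q
  set ψ := fieldRate a b c (k / M) (l / M)
  set ε := |k / M - p| + |l / M - q|
  have hε0 : 0 ≤ ε := by positivity
  have hdiff : |ψ x - φ x| ≤ ε * |x| := abs_fieldRate_sub_le ha hb hab c p q _ _ x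
  obtain ⟨hd1, hd2⟩ := abs_le.1 hdiff
  have hC0 : 0 ≤ C := by
    have := (abs_nonneg _).trans (hC 0); simpa using this
  rcases le_or_gt (h x) 0 with hx | hx
  · have hnot : x ∉ Set.Icc (x₀ - r) (x₀ + r) := fun hmem => by
      linarith [(hnear x hmem).1]
    rw [Set.indicator_of_notMem hnot, zero_sub]
    have hg := hgap x hx
    have habs : |x| ≤ (1 + x ^ 2) / 2 := by
      rw [← sq_abs x]; nlinarith [sq_nonneg (|x| - 1)]
    have hψ : ψ x ≤ φ x₀ - 3 * δ / 4 * (1 + x ^ 2) := by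
      have : ε * |x| ≤ δ / 2 * ((1 + x ^ 2) / 2) := by gcongr; linarith
      linarith
    have hexp : exp (M * ψ x) * exp |x| ≤
        exp (M * (φ x₀ - 3 * δ / 4) + 1 / 2) * exp (-1 * x ^ 2) := by
      rw [← exp_add, ← exp_add, exp_le_exp]
      have h1 : M * ψ x ≤ M * (φ x₀ - 3 * δ / 4 * (1 + x ^ 2)) := by gcongr
      have h2 : 2 * x ^ 2 ≤ M * δ * x ^ 2 := by gcongr
      nlinarith
    have hlow : -(C * exp |x|) ≤ h x := (abs_le.1 (hC x)).1
    calc _ = -(C * (exp (M * (φ x₀ - 3 * δ / 4) + 1 / 2) * exp (-1 * x ^ 2))) := by ring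
      _ ≤ -(C * (exp (M * ψ x) * exp |x|)) := by gcongr
      _ = exp (M * ψ x) * -(C * exp |x|) := by ring
      _ ≤ _ := by gcongr
  · have htail : 0 ≤ C * exp (M * (φ x₀ - 3 * δ / 4) + 1 / 2) * exp (-1 * x ^ 2) := by positivity
    by_cases hmem : x ∈ Set.Icc (x₀ - r) (x₀ + r)
    · rw [Set.indicator_of_mem hmem]
      obtain ⟨hh, hφ⟩ := hnear x hmem
      have habs : |x| ≤ |x₀| + r := by
        have h1 : |x - x₀| ≤ r := abs_le.2 ⟨by linarith [hmem.1], by linarith [hmem.2]⟩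
        have h2 := abs_add_le (x - x₀) x₀
        rw [sub_add_cancel] at h2
        linarith
      have hψ : φ x₀ - δ / 2 ≤ ψ x := by
        have : ε * |x| ≤ ε * (|x₀| + r) := by gcongr
        linarith
      have : δ₀ * exp (M * (φ x₀ - δ / 2)) ≤ h x * exp (M * ψ x) := by gcongr
      linarith [mul_comm (h x) (exp (M * ψ x))]
    · rw [Set.indicator_of_notMem hmem]
      have : 0 ≤ exp (M * ψ x) * h x := by positivity
      linarith

/-- A test function that is positive at every maximizer of the limiting rate eventually has a
positive integral against the field density. -/
lemma eventually_fieldIntegral_pos {a b c p q : ℝ} (ha : 0 < a) (hb : 0 < b) (hab : a + b = 1)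
    (hc : 0 < c) {k l : ℕ → ℕ}
    (hk : Tendsto (fun N : ℕ => (k N : ℝ) / (N + 1)) atTop (𝓝 p))
    (hl : Tendsto (fun N : ℕ => (l N : ℝ) / (N + 1)) atTop (𝓝 q))
    {h : ℝ → ℝ} (hh : Continuous h) {C : ℝ} (hC : ∀ x, |h x| ≤ C * exp |x|)
    (hpos : ∀ x, IsGlobalMax (fieldRate a b c p q) x → 0 < h x) :
    ∀ᶠ N : ℕ in atTop, 0 < fieldIntegral a b c (N + 1) (k N) (l N) h := by
  obtain ⟨x₀, hx₀⟩ := exists_isGlobalMax_fieldRate ha hb hab hc p q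
  obtain ⟨δ, hδ, hgap⟩ := exists_fieldRate_gap ha hb hab hc p q hh hpos hx₀
  set φ := fieldRate a b c p q
  have hφc : Continuous φ := continuous_fieldRate ha hb c p q
  have hh0 := hpos x₀ hx₀
  set δ₀ := h x₀ / 2
  have hδ₀ : 0 < δ₀ := by positivity
  obtain ⟨r, hr, hnear⟩ : ∃ r : ℝ, 0 < r ∧ ∀ x ∈ Set.Icc (x₀ - r) (x₀ + r),
      δ₀ ≤ h x ∧ φ x₀ - δ / 4 ≤ φ x := by
    have e1 : ∀ᶠ x in 𝓝 x₀, δ₀ < h x :=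
      hh.continuousAt.eventually_const_lt (half_lt_self hh0)
    have e2 : ∀ᶠ x in 𝓝 x₀, φ x₀ - δ / 4 < φ x :=
      hφc.continuousAt.eventually_const_lt (by linarith)
    obtain ⟨r, hr, hball⟩ := Metric.nhds_basis_closedBall.eventually_iff.1 (e1.and e2)
    refine ⟨r, hr, fun x hx => ?_⟩
    rw [← Real.closedBall_eq_Icc] at hx
    exact ⟨(hball hx).1.le, (hball hx).2.le⟩
  have hε : Tendsto (fun N : ℕ => |(k N : ℝ) / (N + 1) - p| + |(l N : ℝ) / (N + 1) - q|)
      atTop (𝓝 0) := by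
    simpa using ((hk.sub_const p).abs).add ((hl.sub_const q).abs)
  have hMtop : Tendsto (fun N : ℕ => (N : ℝ) + 1) atTop atTop :=
    tendsto_atTop_add_const_right _ _ tendsto_natCast_atTop_atTop
  have hε' := hε.mul_const (|x₀| + r)
  rw [zero_mul] at hε'
  have hdecay : Tendsto (fun N : ℕ => C * √π * exp (1 / 2) * exp (-(((N : ℝ) + 1) * (δ / 4))))
      atTop (𝓝 0) := by
    have := (tendsto_exp_neg_atTop_nhds_zero.comp
      (hMtop.atTop_mul_const (by positivity : 0 < δ / 4))).const_mul (C * √π * exp (1 / 2))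
    simpa using this
  filter_upwards [hε.eventually_le_const (by positivity : 0 < δ / 2),
    hε'.eventually_le_const (by positivity : 0 < δ / 4),
    (hMtop.atTop_mul_const hδ).eventually_ge_atTop 2,
    hdecay.eventually_lt_const (by positivity : 0 < 2 * r * δ₀)] with N hN1 hN2 hN3 hN4
  set M : ℝ := N + 1 with hMdef
  have hM0 : 0 < M := by positivity
  have hi1 : MeasureTheory.Integrable ((Set.Icc (x₀ - r) (x₀ + r)).indicator
      (fun _ : ℝ => δ₀ * exp (M * (φ x₀ - δ / 2)))) :=
    (MeasureTheory.integrable_indicator_iff measurableSet_Icc).2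
      (MeasureTheory.integrableOn_const (by simp))
  have hi2 : MeasureTheory.Integrable fun x : ℝ =>
      C * exp (M * (φ x₀ - 3 * δ / 4) + 1 / 2) * exp (-1 * x ^ 2) :=
    (integrable_exp_neg_mul_sq one_pos).const_mul _
  have hmono := MeasureTheory.integral_mono (hi1.sub hi2)
    (integrable_fieldDensity_mul ha hb hab hc hM0 (k N) (l N) hh hC)
    (fieldDensity_mul_ge ha hb hab hC hδ₀ hnear hgap hN3 hM0 hN1 hN2)
  refine lt_of_lt_of_le ?_ hmono
  simp only [Pi.sub_apply]
  rw [MeasureTheory.integral_sub hi1 hi2, MeasureTheory.integral_const_mul, integral_gaussian,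
    MeasureTheory.integral_indicator measurableSet_Icc, MeasureTheory.setIntegral_const,
    MeasureTheory.measureReal_def, Real.volume_Icc, ENNReal.toReal_ofReal (by linarith), div_one,
    smul_eq_mul]
  have e : exp (M * (φ x₀ - 3 * δ / 4) + 1 / 2) =
      exp (M * (φ x₀ - δ / 2)) * (exp (1 / 2) * exp (-(M * (δ / 4)))) := by
    rw [← exp_add, ← exp_add]; congr 1; ring
  rw [e]
  have := mul_lt_mul_of_pos_left hN4 (exp_pos (M * (φ x₀ - δ / 2)))
  linarith

lemma fieldIntegral_linear {a b c M : ℝ} (ha : 0 < a) (hb : 0 < b) (hab : a + b = 1)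
    (hc : 0 < c) (hM : 0 < M) (k l : ℕ) {g h : ℝ → ℝ} (hg : Continuous g) (hh : Continuous h)
    {C C' : ℝ} (hC : ∀ x, |g x| ≤ C * exp |x|) (hC' : ∀ x, |h x| ≤ C' * exp |x|) (u v : ℝ) :
    fieldIntegral a b c M k l (fun x => u * g x + v * h x) =
      u * fieldIntegral a b c M k l g + v * fieldIntegral a b c M k l h := by
  unfold fieldIntegral
  rw [← MeasureTheory.integral_const_mul, ← MeasureTheory.integral_const_mul,
    ← MeasureTheory.integral_add
      ((integrable_fieldDensity_mul ha hb hab hc hM k l hg hC).const_mul _)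
      ((integrable_fieldDensity_mul ha hb hab hc hM k l hh hC').const_mul _)]
  congr 1; ext x; ring

lemma fieldIntegral_one_pos {a b c M : ℝ} (ha : 0 < a) (hb : 0 < b) (hab : a + b = 1)
    (hc : 0 < c) (hM : 0 < M) (k l : ℕ) : 0 < fieldIntegral a b c M k l (fun _ => 1) := by
  have hInt := integrable_fieldDensity_mul ha hb hab hc hM k l (h := fun _ => 1)
    continuous_const (C := 1) (fun x => by simp)
  unfold fieldIntegral
  refine MeasureTheory.integral_pos_of_integrable_nonneg_nonzero (x := 0) ?_ hInt ?_ ?_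
  · have h1 := continuous_spinGen a b
    have h2 := continuous_spinGen b a
    fun_prop
  · intro x
    have p1 := spinGen_pos ha hb x
    have p2 := spinGen_pos hb ha x
    simp only [Pi.zero_apply]
    positivity
  · have p1 := spinGen_pos ha hb 0
    have p2 := spinGen_pos hb ha 0
    positivity

lemma abs_spinGen_le {a b : ℝ} (ha : 0 < a) (hb : 0 < b) (hab : a + b = 1) (x : ℝ) :
    |spinGen a b x| ≤ 1 * exp |x| := by
  rw [abs_of_pos (spinGen_pos ha hb x), one_mul]
  exact spinGen_le_exp_abs ha hb hab x

/-- If the limiting rate has a unique maximizer, field averages converge to the value there. -/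
lemma tendsto_fieldAverage {a b c p q : ℝ} (ha : 0 < a) (hb : 0 < b) (hab : a + b = 1)
    (hc : 0 < c) {k l : ℕ → ℕ}
    (hk : Tendsto (fun N : ℕ => (k N : ℝ) / (N + 1)) atTop (𝓝 p))
    (hl : Tendsto (fun N : ℕ => (l N : ℝ) / (N + 1)) atTop (𝓝 q))
    (huniq : UniqueGlobalMax (fieldRate a b c p q)) {x₀ : ℝ}
    (hx₀ : IsGlobalMax (fieldRate a b c p q) x₀)
    {g : ℝ → ℝ} (hg : Continuous g) {C : ℝ} (hC : ∀ x, |g x| ≤ C * exp |x|) :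
    Tendsto (fun N : ℕ => fieldIntegral a b c (N + 1) (k N) (l N) g /
      fieldIntegral a b c (N + 1) (k N) (l N) (fun _ => 1)) atTop (𝓝 (g x₀)) := by
  have hone : ∀ x : ℝ, |(1 : ℝ)| ≤ 1 * exp |x| := fun x => by simp
  have key : ∀ u v : ℝ, 0 < u * g x₀ + v * 1 → ∀ᶠ N : ℕ in atTop,
      0 < u * fieldIntegral a b c (N + 1) (k N) (l N) g +
        v * fieldIntegral a b c (N + 1) (k N) (l N) (fun _ => 1) := by
    intro u v huv
    have hbd : ∀ x, |u * g x + v * 1| ≤ (|u| * C + |v|) * exp |x| := fun x => by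
      calc |u * g x + v * 1| ≤ |u * g x| + |v * 1| := abs_add_le _ _
        _ = |u| * |g x| + |v| * |1| := by rw [abs_mul, abs_mul]
        _ ≤ |u| * (C * exp |x|) + |v| * (1 * exp |x|) := by gcongr; exacts [hC x, hone x]
        _ = _ := by ring
    have := eventually_fieldIntegral_pos ha hb hab hc hk hl
      (h := fun x => u * g x + v * 1) (by fun_prop) hbd
      (fun x hx => by rw [huniq x x₀ hx hx₀]; exact huv)
    filter_upwards [this] with N hN
    rwa [fieldIntegral_linear ha hb hab hc (by positivity) _ _ hg continuous_const hC hone] at hN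
  rw [Metric.tendsto_nhds]
  intro ε hε
  filter_upwards [key 1 (ε - g x₀) (by linarith), key (-1) (ε + g x₀) (by linarith)] with N h1 h2
  have hpos := fieldIntegral_one_pos ha hb hab hc (by positivity : (0 : ℝ) < N + 1) (k N) (l N)
  rw [Real.dist_eq, abs_lt]
  constructor
  · rw [lt_sub_iff_add_lt, lt_div_iff₀ hpos]; linarith
  · rw [sub_lt_iff_lt_add, div_lt_iff₀ hpos]; linarith

/-! ### Uniqueness of maximizers -/

lemma fieldRate_smul (a b c p q s x : ℝ) :
    fieldRate a b (s * c) (s * p) (s * q) x = s * fieldRate a b c p q x := by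
  unfold fieldRate; ring

lemma uniqueGlobalMax_fieldRate_smul_iff (a b c p q : ℝ) {s : ℝ} (hs : 0 < s) :
    UniqueGlobalMax (fieldRate a b (s * c) (s * p) (s * q)) ↔
      UniqueGlobalMax (fieldRate a b c p q) := by
  simp only [UniqueGlobalMax, IsGlobalMax, fieldRate_smul, mul_le_mul_iff_right₀ hs]

lemma fieldRate_neg (a b c p q x : ℝ) :
    fieldRate a b c p q (-x) = fieldRate a b c q p x := by
  unfold fieldRate; rw [spinGen_neg, spinGen_neg]; ring

lemma UniqueGlobalMax.fieldRate_swap {a b c p q : ℝ}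
    (h : UniqueGlobalMax (fieldRate a b c p q)) : UniqueGlobalMax (fieldRate a b c q p) := by
  have hneg : ∀ x, IsGlobalMax (fieldRate a b c q p) x →
      IsGlobalMax (fieldRate a b c p q) (-x) := fun x hx y => by
    have := hx (-y)
    rwa [fieldRate_neg, ← fieldRate_neg a b c p q x] at this
  intro x y hx hy
  exact neg_injective (h _ _ (hneg x hx) (hneg y hy))

/-- Logarithmic derivative of `spinGen`. -/
noncomputable def spinMean (a b x : ℝ) : ℝ := (a * exp x - b * exp (-x)) / spinGen a b x

lemma hasDerivAt_spinGen (a b x : ℝ) :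
    HasDerivAt (spinGen a b) (a * exp x - b * exp (-x)) x := by
  have h := ((hasDerivAt_exp x).const_mul a).add (((hasDerivAt_neg x).exp).const_mul b)
  exact h.congr_deriv (by ring)

lemma hasDerivAt_spinMean {a b : ℝ} (ha : 0 < a) (hb : 0 < b) (x : ℝ) :
    HasDerivAt (spinMean a b) (1 - spinMean a b x ^ 2) x := by
  have hp := (spinGen_pos ha hb x).ne'
  have h1 : HasDerivAt (fun x => a * exp x - b * exp (-x)) (spinGen a b x) x := by
    have h := ((hasDerivAt_exp x).const_mul a).sub (((hasDerivAt_neg x).exp).const_mul b)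
    exact h.congr_deriv (by simp [spinGen])
  refine (h1.div (hasDerivAt_spinGen a b x) hp).congr_deriv ?_
  unfold spinMean
  field_simp

lemma spinMean_sq_lt_one {a b : ℝ} (ha : 0 < a) (hb : 0 < b) (x : ℝ) :
    spinMean a b x ^ 2 < 1 := by
  have hp := spinGen_pos ha hb x
  unfold spinMean
  rw [div_pow, div_lt_one (by positivity), spinGen]
  nlinarith [mul_pos (mul_pos ha (exp_pos x)) (mul_pos hb (exp_pos (-x)))]

lemma strictMono_spinMean {a b : ℝ} (ha : 0 < a) (hb : 0 < b) : StrictMono (spinMean a b) := by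
  refine strictMono_of_deriv_pos fun x => ?_
  rw [(hasDerivAt_spinMean ha hb x).deriv]
  linarith [spinMean_sq_lt_one ha hb x]

lemma spinMean_zero_pos {a b : ℝ} (hb : 0 < b) (hba : b < a) : 0 < spinMean a b 0 := by
  unfold spinMean
  exact div_pos (by simpa using hba) (spinGen_pos (hb.trans hba) hb 0)

lemma strictConcaveOn_spinMean {a b : ℝ} (hb : 0 < b) (hba : b < a) :
    StrictConcaveOn ℝ (Set.Ici 0) (spinMean a b) := by
  have ha := hb.trans hba
  refine StrictAntiOn.strictConcaveOn_of_deriv (convex_Ici 0)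
    (fun x _ => (hasDerivAt_spinMean ha hb x).continuousAt.continuousWithinAt) ?_
  intro x hx y hy hxy
  rw [interior_Ici, Set.mem_Ioi] at hx hy
  rw [(hasDerivAt_spinMean ha hb x).deriv, (hasDerivAt_spinMean ha hb y).deriv]
  have h0 := spinMean_zero_pos hb hba
  have h1 := strictMono_spinMean ha hb hx
  have h2 := strictMono_spinMean ha hb hxy
  have : spinMean a b x ^ 2 < spinMean a b y ^ 2 := by gcongr; linarith
  linarith

lemma hasDerivAt_fieldRate_zero_right {a b : ℝ} (ha : 0 < a) (hb : 0 < b) (c p x : ℝ) :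
    HasDerivAt (fieldRate a b c p 0) (-(2 * c * x) + p * spinMean a b x) x := by
  have h1 := ((hasDerivAt_pow 2 x).const_mul (-c)).add
    (((hasDerivAt_spinGen a b x).log (spinGen_pos ha hb x).ne').const_mul p)
  have e : fieldRate a b c p 0 =
      (fun x => -c * x ^ 2) + fun x => p * log (spinGen a b x) := by
    ext x; simp [fieldRate]
  rw [e]
  refine h1.congr_deriv ?_
  simp [spinMean]; ring

lemma uniqueGlobalMax_fieldRate_zero_right {a b c p : ℝ} (hb : 0 < b) (hba : b < a)
    (hc : 0 < c) (hp : 0 ≤ p) : UniqueGlobalMax (fieldRate a b c p 0) := by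
  have ha := hb.trans hba
  rcases hp.eq_or_lt with rfl | hp
  · have hz : ∀ x, IsGlobalMax (fieldRate a b c 0 0) x → x = 0 := fun x hx => by
      have := hx 0
      simp [fieldRate] at this
      have h2 : x ^ 2 ≤ 0 := by nlinarith [sq_nonneg x]
      exact pow_eq_zero_iff two_ne_zero |>.1 (le_antisymm h2 (sq_nonneg x))
    intro x y hx hy
    rw [hz x hx, hz y hy]
  have hcrit : ∀ x, IsGlobalMax (fieldRate a b c p 0) x → p * spinMean a b x = 2 * c * x := by
    intro x hx
    have := IsLocalMax.hasDerivAt_eq_zero (Filter.Eventually.of_forall hx)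
      (hasDerivAt_fieldRate_zero_right ha hb c p x)
    linarith
  have hposx : ∀ x, IsGlobalMax (fieldRate a b c p 0) x → 0 < x := by
    intro x hx
    rcases lt_trichotomy x 0 with h | rfl | h
    · exfalso
      have h1 := hx (-x)
      have h2 : spinGen a b x < spinGen a b (-x) := by
        have : exp x < exp (-x) := exp_lt_exp.2 (by linarith)
        simp only [spinGen, neg_neg]; nlinarith
      have h3 := log_lt_log (spinGen_pos ha hb x) h2
      simp only [fieldRate, neg_sq, zero_mul, add_zero] at h1
      nlinarith
    · exfalso
      have h1 := hcrit 0 hx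
      have h2 := mul_pos hp (spinMean_zero_pos hb hba)
      linarith
    · exact h
  have hlt : ∀ x y, IsGlobalMax (fieldRate a b c p 0) x → IsGlobalMax (fieldRate a b c p 0) y →
      ¬ x < y := by
    intro x y hx hy hxy
    have hx0 := hposx x hx
    have hy0 := hposx y hy
    have hconc := (strictConcaveOn_spinMean hb hba).2 (Set.mem_Ici.2 le_rfl)
      (Set.mem_Ici.2 hy0.le) hy0.ne
      (sub_pos.2 ((div_lt_one hy0).2 hxy)) (div_pos hx0 hy0) (sub_add_cancel 1 (x / y))
    simp only [smul_eq_mul, mul_zero, zero_add, div_mul_cancel₀ _ hy0.ne'] at hconc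
    have h1 : 0 < (1 - x / y) * spinMean a b 0 :=
      mul_pos (by rw [sub_pos, div_lt_one hy0]; exact hxy) (spinMean_zero_pos hb hba)
    have h2 : p * (x / y * spinMean a b y) < p * spinMean a b x :=
      mul_lt_mul_of_pos_left (by linarith) hp
    have h3 : p * (x / y * spinMean a b y) = 2 * c * x := by
      rw [mul_left_comm, hcrit y hy]; field_simp
    linarith [hcrit x hx]
  intro x y hx hy
  exact le_antisymm (not_lt.1 (hlt y x hy hx)) (not_lt.1 (hlt x y hx hy))

/-! ### Tilted boundary conditions at a point of non-uniqueness -/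

lemma IsGlobalMax.mul_sub_nonneg_of_tilt {a b c p q s x₀ y : ℝ} (hb : 0 < b) (hba : b < a)
    (hx₀ : IsGlobalMax (fieldRate a b c p q) x₀)
    (hy : IsGlobalMax (fieldRate a b c (p + s) (q - s)) y) : 0 ≤ s * (y - x₀) := by
  have ha := hb.trans hba
  have h1 := hx₀ y
  have h2 := hy x₀
  have hmono : ∀ u v, u < v → log (spinGen a b u) - log (spinGen b a u) <
      log (spinGen a b v) - log (spinGen b a v) := by
    intro u v huv
    have := log_lt_log (mul_pos (spinGen_pos ha hb u) (spinGen_pos hb ha v))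
      (spinGen_mul_lt hb hba huv)
    rw [log_mul (spinGen_pos ha hb u).ne' (spinGen_pos hb ha v).ne',
      log_mul (spinGen_pos ha hb v).ne' (spinGen_pos hb ha u).ne'] at this
    linarith
  have h3 : 0 ≤ s * ((log (spinGen a b y) - log (spinGen b a y)) -
      (log (spinGen a b x₀) - log (spinGen b a x₀))) := by
    unfold fieldRate at h1 h2; linarith
  by_contra hcon
  push Not at hcon
  rcases mul_neg_iff.1 hcon with ⟨hs1, hs2⟩ | ⟨hs1, hs2⟩
  · nlinarith [hmono y x₀ (by linarith)]
  · nlinarith [hmono x₀ y (by linarith)]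

lemma exists_diagonal {P : ℕ → ℕ → Prop} (h : ∀ j, ∀ᶠ N in atTop, P j N) :
    ∃ J : ℕ → ℕ, Tendsto J atTop atTop ∧ ∀ᶠ N in atTop, P (J N) N := by
  classical
  choose N₀ hN₀ using fun j => eventually_atTop.1 (h j)
  refine ⟨fun N => Nat.findGreatest (fun j => N₀ j ≤ N) N, ?_, ?_⟩
  · refine tendsto_atTop.2 fun j => ?_
    filter_upwards [eventually_ge_atTop j, eventually_ge_atTop (N₀ j)] with N h1 h2
    exact Nat.le_findGreatest h1 h2
  · filter_upwards [eventually_ge_atTop (N₀ 0)] with N hN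
    exact hN₀ _ _ (Nat.findGreatest_spec (P := fun j => N₀ j ≤ N) (Nat.zero_le N) hN)

lemma tendsto_div_succ_iff {u : ℕ → ℝ} {p : ℝ} :
    Tendsto (fun N : ℕ => u N / (N + 1)) atTop (𝓝 p) ↔
      Tendsto (fun N : ℕ => u N / N) atTop (𝓝 p) := by
  have h1 : Tendsto (fun N : ℕ => (N : ℝ) / (N + 1)) atTop (𝓝 1) :=
    tendsto_natCast_div_add_atTop 1
  have h2 : Tendsto (fun N : ℕ => ((N : ℝ) + 1) / N) atTop (𝓝 1) := by
    simpa using h1.inv₀ one_ne_zero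
  constructor
  · intro h
    have := h.mul h2
    rw [mul_one] at this
    refine this.congr fun N => ?_
    have : (N : ℝ) + 1 ≠ 0 := by positivity
    rw [div_mul_div_comm, mul_comm (u N), mul_div_mul_left _ _ this]
  · intro h
    have := h.mul h1
    rw [mul_one] at this
    refine this.congr' ?_
    filter_upwards [eventually_gt_atTop 0] with N hN
    have : (N : ℝ) ≠ 0 := by positivity
    rw [div_mul_div_comm, mul_comm (u N), mul_div_mul_left _ _ this]

lemma tendsto_floor_mul_div_succ {p : ℝ} (hp : 0 ≤ p) :
    Tendsto (fun N : ℕ => (⌊p * N⌋₊ : ℝ) / (N + 1)) atTop (𝓝 p) :=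
  tendsto_div_succ_iff.2 ((tendsto_nat_floor_mul_div_atTop hp).comp tendsto_natCast_atTop_atTop)

/-- At a maximizer `x₀`, boundary conditions approaching `(p, q)` slowly from the side `e` force
the field to concentrate on the side `e` of `x₀`. -/
lemma exists_tilted_counts {a b c p q x₀ e : ℝ} (hb : 0 < b) (hba : b < a) (hab : a + b = 1)
    (hc : 0 < c) (hp : 0 < p) (hq : 0 < q) (hx₀ : IsGlobalMax (fieldRate a b c p q) x₀)
    (he : e = 1 ∨ e = -1) {h : ℝ → ℝ} (hh : Continuous h) {C : ℝ}
    (hC : ∀ x, |h x| ≤ C * exp |x|) (hpos : ∀ x, 0 ≤ e * (x - x₀) → 0 < h x) :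
    ∃ k l : ℕ → ℕ, (∀ N : ℕ, k N + l N = ⌊(p + q) * N⌋₊) ∧
      Tendsto (fun N : ℕ => (k N : ℝ) / N) atTop (𝓝 p) ∧
      Tendsto (fun N : ℕ => (l N : ℝ) / N) atTop (𝓝 q) ∧
      ∀ᶠ N : ℕ in atTop, 0 < fieldIntegral a b c (N + 1) (k N) (l N) h := by
  have ha := hb.trans hba
  set s : ℕ → ℝ := fun j => min p q / ((j : ℝ) + 1) with hs
  have hm : 0 < min p q := lt_min hp hq
  have hs0 : ∀ j, 0 < s j := fun j => by positivity
  have hsle : ∀ j, s j ≤ min p q := fun j => div_le_self hm.le (by simp)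
  have hsp : ∀ j, s j ≤ p := fun j => (hsle j).trans (min_le_left _ _)
  have hsq : ∀ j, s j ≤ q := fun j => (hsle j).trans (min_le_right _ _)
  have hslim : Tendsto s atTop (𝓝 0) := by
    simpa [hs, div_eq_mul_inv] using
      (tendsto_one_div_add_atTop_nhds_zero_nat (𝕜 := ℝ)).const_mul (min p q)
  have hpj : ∀ j, 0 ≤ p + e * s j := fun j => by
    rcases he with rfl | rfl <;> linarith [hs0 j, hsp j]
  have hpjle : ∀ j, p + e * s j ≤ p + q := fun j => by
    rcases he with rfl | rfl <;> linarith [hs0 j, hsq j]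
  set k : ℕ → ℕ → ℕ := fun j N => ⌊(p + e * s j) * N⌋₊
  set l : ℕ → ℕ → ℕ := fun j N => ⌊(p + q) * N⌋₊ - k j N
  have hkle : ∀ j N, k j N ≤ ⌊(p + q) * N⌋₊ := fun j N =>
    Nat.floor_mono (mul_le_mul_of_nonneg_right (hpjle j) (by positivity))
  have hklim : ∀ j, Tendsto (fun N : ℕ => (k j N : ℝ) / (N + 1)) atTop (𝓝 (p + e * s j)) :=
    fun j => tendsto_floor_mul_div_succ (hpj j)
  have hllim : ∀ j, Tendsto (fun N : ℕ => (l j N : ℝ) / (N + 1)) atTop (𝓝 (q - e * s j)) := by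
    intro j
    have := (tendsto_floor_mul_div_succ (by positivity : 0 ≤ p + q)).sub (hklim j)
    rw [show p + q - (p + e * s j) = q - e * s j by ring] at this
    refine this.congr fun N => ?_
    simp only [l]
    rw [Nat.cast_sub (hkle j N), sub_div]
  have hev : ∀ j, ∀ᶠ N : ℕ in atTop,
      |(k j N : ℝ) / (N + 1) - (p + e * s j)| ≤ 1 / ((j : ℝ) + 1) ∧
      |(l j N : ℝ) / (N + 1) - (q - e * s j)| ≤ 1 / ((j : ℝ) + 1) ∧
      0 < fieldIntegral a b c (N + 1) (k j N) (l j N) h := by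
    intro j
    have hj : (0 : ℝ) < 1 / ((j : ℝ) + 1) := by positivity
    have h1 := ((hklim j).sub_const (p + e * s j)).abs
    have h2 := ((hllim j).sub_const (q - e * s j)).abs
    rw [sub_self, abs_zero] at h1 h2
    refine (h1.eventually_le_const hj).and ((h2.eventually_le_const hj).and ?_)
    refine eventually_fieldIntegral_pos ha hb hab hc (hklim j) (hllim j) hh hC fun y hy => ?_
    have := hx₀.mul_sub_nonneg_of_tilt hb hba hy
    refine hpos y ?_
    rw [mul_comm e, mul_assoc] at this
    exact nonneg_of_mul_nonneg_right this (hs0 j)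
  obtain ⟨J, hJ, hJev⟩ := exists_diagonal hev
  have hinv : Tendsto (fun N => 1 / ((J N : ℝ) + 1)) atTop (𝓝 0) :=
    tendsto_one_div_add_atTop_nhds_zero_nat.comp hJ
  have hsJ := (hslim.comp hJ).const_mul e
  rw [mul_zero] at hsJ
  have hlim : ∀ {u v : ℕ → ℝ} {w : ℝ}, (∀ᶠ N in atTop, |u N - v N| ≤ 1 / ((J N : ℝ) + 1)) →
      Tendsto v atTop (𝓝 w) → Tendsto u atTop (𝓝 w) := by
    intro u v w h1 h2
    have := (squeeze_zero_norm' h1 hinv).add h2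
    simpa using this
  refine ⟨fun N => k (J N) N, fun N => l (J N) N, fun N => Nat.add_sub_of_le (hkle _ _),
    tendsto_div_succ_iff.1 (hlim (hJev.mono fun N h => h.1) ?_),
    tendsto_div_succ_iff.1 (hlim (hJev.mono fun N h => h.2.1) ?_), hJev.mono fun N h => h.2.2⟩
  · simpa using hsJ.const_add p
  · simpa using hsJ.const_sub q

/-! ### Field representation of the time-evolved weights -/

/-- Number of sites with spin value `s`. -/
def spinCount {S : Finset ℤ} {N : ℕ} (τ : Fin N → S) (s : ℤ) : ℕ :=
  (univ.filter fun i : Fin N => (τ i : ℤ) = s).card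

lemma prod_eq_prod_pow_spinCount {S : Finset ℤ} {N : ℕ} (τ : Fin N → S) (G : ℤ → ℝ) :
    ∏ i, G (τ i) = ∏ s ∈ S, G s ^ spinCount τ s := by
  rw [← Finset.prod_fiberwise_of_maps_to (t := S) (g := fun i => (τ i : ℤ))
    (fun i _ => (τ i).2)]
  refine Finset.prod_congr rfl fun s _ => ?_
  rw [Finset.prod_congr rfl (g := fun _ => G s)
    (fun i hi => by rw [(Finset.mem_filter.1 hi).2]), Finset.prod_const, spinCount]

lemma sum_eq_sum_spinCount_mul {S : Finset ℤ} {N : ℕ} (τ : Fin N → S) (G : ℤ → ℝ) :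
    ∑ i, G (τ i) = ∑ s ∈ S, spinCount τ s * G s := by
  rw [← Finset.sum_fiberwise_of_maps_to (t := S) (g := fun i => (τ i : ℤ))
    (fun i _ => (τ i).2)]
  refine Finset.sum_congr rfl fun s _ => ?_
  rw [Finset.sum_congr rfl (g := fun _ => G s)
    (fun i hi => by rw [(Finset.mem_filter.1 hi).2]), Finset.sum_const, spinCount,
    nsmul_eq_mul]

/-- Hubbard–Stratonovich transform of a mean-field sum with quadratic interaction. -/
lemma sum_exp_sq_mul_prod {S : Finset ℤ} {n : ℕ} {A : ℝ} (hA : 0 < A) (u : Fin n → S → ℝ) :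
    ∑ ω : Fin n → S, exp ((∑ i, ((ω i : ℤ) : ℝ)) ^ 2 / (4 * A)) * ∏ i, u i (ω i) =
      (√(π / A))⁻¹ * ∫ x, exp (-A * x ^ 2) * ∏ i, ∑ s : S, u i s * exp (x * ((s : ℤ) : ℝ)) := by
  have hsqrt : √(π / A) ≠ 0 := (Real.sqrt_pos.2 (by positivity)).ne'
  have hprod : ∀ x, exp (-A * x ^ 2) * ∏ i, ∑ s : S, u i s * exp (x * ((s : ℤ) : ℝ)) =
      ∑ ω : Fin n → S, (∏ i, u i (ω i)) *
        (exp (-A * x ^ 2) * exp (x * ∑ i, ((ω i : ℤ) : ℝ))) := by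
    intro x
    rw [Finset.prod_univ_sum, Fintype.piFinset_univ, Finset.mul_sum]
    refine Finset.sum_congr rfl fun ω _ => ?_
    rw [Finset.prod_mul_distrib, Finset.mul_sum, exp_sum]
    ring
  simp_rw [hprod]
  rw [MeasureTheory.integral_finsetSum _
    fun ω _ => (integrable_exp_quadratic hA _).const_mul _, Finset.mul_sum]
  refine Finset.sum_congr rfl fun ω _ => ?_
  rw [MeasureTheory.integral_const_mul, integral_exp_quadratic hA]
  field_simp

/-- Probability of no net flip up to time `t`. -/
noncomputable def stayProb (t : ℝ) : ℝ := (1 + exp (-2 * t)) / 2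

/-- Probability of a net flip up to time `t`. -/
noncomputable def flipProb (t : ℝ) : ℝ := (1 - exp (-2 * t)) / 2

lemma flipProb_pos {t : ℝ} (ht : 0 < t) : 0 < flipProb t := by
  have : exp (-2 * t) < 1 := Real.exp_lt_one_iff.2 (by linarith)
  unfold flipProb; linarith

lemma flipProb_lt_stayProb (t : ℝ) : flipProb t < stayProb t := by
  have := exp_pos (-2 * t)
  unfold flipProb stayProb; linarith

lemma stayProb_add_flipProb (t : ℝ) : stayProb t + flipProb t = 1 := by
  unfold flipProb stayProb; ring

/-- Generating function of the initial spin given its final value `s`. -/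
noncomputable def siteGen (t : ℝ) (s : ℤ) (x : ℝ) : ℝ :=
  if s = 1 then spinGen (stayProb t) (flipProb t) x
  else if s = -1 then spinGen (flipProb t) (stayProb t) x else 1

/-- The field integral for the flip dynamics, with an additional site of spin `s`. -/
noncomputable def siteIntegral (t c M : ℝ) (k l : ℕ) (s : ℤ) : ℝ :=
  fieldIntegral (stayProb t) (flipProb t) c M k l (siteGen t s)

lemma sum_spin (F : Spin → ℝ) :
    ∑ σ : Spin, F σ = F ⟨-1, by decide⟩ + F ⟨0, by decide⟩ + F ⟨1, by decide⟩ := by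
  have : (univ : Finset Spin) = {⟨-1, by decide⟩, ⟨0, by decide⟩, ⟨1, by decide⟩} := by decide
  rw [this, Finset.sum_insert (by decide), Finset.sum_insert (by decide), Finset.sum_singleton,
    add_assoc]

lemma sum_iSpin (F : ISpin → ℝ) :
    ∑ σ : ISpin, F σ = F ⟨-1, by decide⟩ + F ⟨1, by decide⟩ := by
  have : (univ : Finset ISpin) = {⟨-1, by decide⟩, ⟨1, by decide⟩} := by decide
  rw [this, Finset.sum_insert (by decide), Finset.sum_singleton]

lemma spin_cases (s : Spin) : (s : ℤ) = -1 ∨ (s : ℤ) = 0 ∨ (s : ℤ) = 1 := by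
  obtain ⟨s, hs⟩ := s
  simpa [Spin] using hs

lemma iSpin_cases (s : ISpin) : (s : ℤ) = -1 ∨ (s : ℤ) = 1 := by
  obtain ⟨s, hs⟩ := s
  simpa [ISpin] using hs

lemma sum_spin_pFlip (α : ℤ → ℝ) (hsym : α 1 = α (-1)) (t x : ℝ) (η : Spin) :
    ∑ s : Spin, α s * pFlip t s η * exp (x * ((s : ℤ) : ℝ)) = α η * siteGen t η x := by
  rw [sum_spin]
  rcases spin_cases η with h | h | h <;>
    simp [h, pFlip, siteGen, spinGen, stayProb, flipProb, hsym] <;> ring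

lemma sum_iSpin_pFlip (t x : ℝ) (η : ISpin) :
    ∑ s : ISpin, pFlip t s η * exp (x * ((s : ℤ) : ℝ)) = siteGen t η x := by
  rw [sum_iSpin]
  rcases iSpin_cases η with h | h <;>
    simp [h, pFlip, siteGen, spinGen, stayProb, flipProb, add_comm]

lemma sum_sum_opposite {n : ℕ} (ω : Fin n → Spin) :
    ∑ i, ∑ j, (if ((ω i : ℤ) * (ω j : ℤ) = -1) then (1 : ℝ) else 0) =
      ((∑ i, ((ω i : ℤ) : ℝ) ^ 2) ^ 2 - (∑ i, ((ω i : ℤ) : ℝ)) ^ 2) / 2 := by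
  have h : ∀ i j, (if ((ω i : ℤ) * (ω j : ℤ) = -1) then (1 : ℝ) else 0) =
      (((ω i : ℤ) : ℝ) ^ 2 * ((ω j : ℤ) : ℝ) ^ 2 - ((ω i : ℤ) : ℝ) * ((ω j : ℤ) : ℝ)) / 2 := by
    intro i j
    rcases spin_cases (ω i) with h | h | h <;> rcases spin_cases (ω j) with h' | h' | h' <;>
      simp [h, h']
  simp_rw [h]
  rw [pow_two (∑ i, ((ω i : ℤ) : ℝ) ^ 2), pow_two (∑ i, ((ω i : ℤ) : ℝ)),
    Finset.sum_mul_sum, Finset.sum_mul_sum, ← Finset.sum_sub_distrib, Finset.sum_div]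
  refine Finset.sum_congr rfl fun i _ => ?_
  rw [← Finset.sum_sub_distrib, Finset.sum_div]

lemma sq_eq_of_pFlip_ne_zero {t : ℝ} {s η : Spin} (h : pFlip t s η ≠ 0) :
    ((s : ℤ) : ℝ) ^ 2 = ((η : ℤ) : ℝ) ^ 2 := by
  rcases spin_cases s with h1 | h1 | h1 <;> rcases spin_cases η with h2 | h2 | h2 <;>
    simp [h1, h2, pFlip] at h ⊢

lemma wrWeightT_eq {β t : ℝ} (hβ : 0 < β) {α : ℤ → ℝ} (hsym : α 1 = α (-1)) {n : ℕ} (hn : 0 < n)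
    (η : Fin n → Spin) :
    wrWeightT β α t η = exp (-(β * (∑ i, ((η i : ℤ) : ℝ) ^ 2) ^ 2 / (4 * n))) *
      ((√(π / (1 / β * n)))⁻¹ *
        ∫ x, exp (-(1 / β * n) * x ^ 2) * ∏ i, (α (η i) * siteGen t (η i) x)) := by
  have hn' : (0 : ℝ) < n := by exact_mod_cast hn
  have hHS := sum_exp_sq_mul_prod (S := Spin) (A := 1 / β * n) (by positivity)
    (fun i s => α s * pFlip t s (η i))
  simp_rw [sum_spin_pFlip α hsym] at hHS
  rw [← hHS, Finset.mul_sum]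
  unfold wrWeightT wrWeight
  refine Finset.sum_congr rfl fun ω _ => ?_
  by_cases h0 : ∏ i, pFlip t (ω i) (η i) = 0
  · rw [Finset.prod_mul_distrib, h0]; simp
  · have hsq : ∑ i, ((ω i : ℤ) : ℝ) ^ 2 = ∑ i, ((η i : ℤ) : ℝ) ^ 2 :=
      Finset.sum_congr rfl fun i _ =>
        sq_eq_of_pFlip_ne_zero ((Finset.prod_ne_zero_iff.1 h0) i (Finset.mem_univ i))
    rw [sum_sum_opposite, hsq, Finset.prod_mul_distrib, ← mul_assoc, ← mul_assoc, ← mul_assoc,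
      ← exp_add]
    congr 3
    field_simp
    ring

lemma isingWeightT_eq {βI t : ℝ} (hβ : 0 < βI) {n : ℕ} (hn : 0 < n) (η : Fin n → ISpin) :
    isingWeightT βI t η = (2 : ℝ) ^ (-(n : ℤ)) * ((√(π / (1 / (2 * βI) * n)))⁻¹ *
      ∫ x, exp (-(1 / (2 * βI) * n) * x ^ 2) * ∏ i, siteGen t (η i) x) := by
  have hn' : (0 : ℝ) < n := by exact_mod_cast hn
  have hHS := sum_exp_sq_mul_prod (S := ISpin) (A := 1 / (2 * βI) * n) (by positivity)
    (fun i s => pFlip t s (η i))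
  simp_rw [sum_iSpin_pFlip] at hHS
  rw [← hHS, Finset.mul_sum]
  unfold isingWeightT
  refine Finset.sum_congr rfl fun ω _ => ?_
  rw [mul_comm (exp _), mul_assoc]
  congr 3
  field_simp
  ring

lemma siteGen_one (t : ℝ) : siteGen t 1 = spinGen (stayProb t) (flipProb t) := by
  ext x; simp [siteGen]

lemma siteGen_neg_one (t : ℝ) : siteGen t (-1) = spinGen (flipProb t) (stayProb t) := by
  ext x; simp [siteGen]

lemma siteGen_zero (t : ℝ) : siteGen t 0 = fun _ => 1 := by
  ext x; simp [siteGen]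

lemma continuous_siteGen (t : ℝ) (s : ℤ) : Continuous (siteGen t s) := by
  unfold siteGen
  split_ifs
  exacts [continuous_spinGen _ _, continuous_spinGen _ _, continuous_const]

lemma siteGen_pos {t : ℝ} (ht : 0 < t) (s : ℤ) (x : ℝ) : 0 < siteGen t s x := by
  have hb := flipProb_pos ht
  have ha := hb.trans (flipProb_lt_stayProb t)
  unfold siteGen
  split_ifs
  exacts [spinGen_pos ha hb x, spinGen_pos hb ha x, one_pos]

lemma abs_siteGen_le {t : ℝ} (ht : 0 < t) (s : ℤ) (x : ℝ) : |siteGen t s x| ≤ 1 * exp |x| := by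
  have hb := flipProb_pos ht
  have ha := hb.trans (flipProb_lt_stayProb t)
  have hab := stayProb_add_flipProb t
  unfold siteGen
  split_ifs
  exacts [abs_spinGen_le ha hb hab x, abs_spinGen_le hb ha (by linarith) x, by simp]

/-- Prefactor of the Widom-Rowlinson conditional weights not depending on the first spin. -/
noncomputable def wrPrefactor (β : ℝ) (α : ℤ → ℝ) {N : ℕ} (τ : Fin N → Spin) : ℝ :=
  (√(π / (1 / β * (N + 1))))⁻¹ * ∏ s ∈ Spin, α s ^ spinCount τ s

lemma wrPrefactor_pos {β : ℝ} (hβ : 0 < β) {α : ℤ → ℝ} (hα : ∀ s ∈ Spin, 0 < α s) {N : ℕ}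
    (τ : Fin N → Spin) : 0 < wrPrefactor β α τ :=
  mul_pos (inv_pos.2 (Real.sqrt_pos.2 (by positivity)))
    (Finset.prod_pos fun s hs => pow_pos (hα s hs) _)

lemma sum_sq_eq_spinCount {N : ℕ} (τ : Fin N → Spin) :
    ∑ i, ((τ i : ℤ) : ℝ) ^ 2 = spinCount τ 1 + spinCount τ (-1) := by
  rw [sum_eq_sum_spinCount_mul τ fun s => (s : ℝ) ^ 2]
  simp [Spin]; ring

lemma wrWeightT_cons {β t : ℝ} (hβ : 0 < β) {α : ℤ → ℝ} (hsym : α 1 = α (-1)) {N : ℕ}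
    (σ : Spin) (τ : Fin N → Spin) :
    wrWeightT β α t (Fin.cons σ τ : Fin (N + 1) → Spin) = wrPrefactor β α τ *
      (exp (-(β * (((σ : ℤ) : ℝ) ^ 2 + (spinCount τ 1 + spinCount τ (-1))) ^ 2 /
        (4 * ((N : ℝ) + 1)))) * α σ *
      siteIntegral t (1 / β) (N + 1) (spinCount τ 1) (spinCount τ (-1)) σ) := by
  rw [wrWeightT_eq hβ hsym N.succ_pos, Fin.sum_univ_succ]
  simp only [Fin.prod_univ_succ, Fin.cons_zero, Fin.cons_succ, sum_sq_eq_spinCount]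
  have hprod : ∀ x, ∏ i, (α (τ i) * siteGen t (τ i) x) =
      (∏ s ∈ Spin, α s ^ spinCount τ s) *
        (spinGen (stayProb t) (flipProb t) x ^ spinCount τ 1 *
          spinGen (flipProb t) (stayProb t) x ^ spinCount τ (-1)) := by
    intro x
    rw [prod_eq_prod_pow_spinCount τ fun s => α s * siteGen t s x]
    simp_rw [mul_pow]
    rw [Finset.prod_mul_distrib]
    congr 1
    simp [Spin, siteGen, mul_comm]
  simp_rw [hprod]
  have hInt : ∀ x, exp (-(1 / β * ((N + 1 : ℕ) : ℝ)) * x ^ 2) *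
      (α σ * siteGen t σ x * ((∏ s ∈ Spin, α s ^ spinCount τ s) *
        (spinGen (stayProb t) (flipProb t) x ^ spinCount τ 1 *
          spinGen (flipProb t) (stayProb t) x ^ spinCount τ (-1)))) =
      (α σ * ∏ s ∈ Spin, α s ^ spinCount τ s) *
        (exp (-(1 / β * ((N : ℝ) + 1)) * x ^ 2) *
          spinGen (stayProb t) (flipProb t) x ^ spinCount τ 1 *
          spinGen (flipProb t) (stayProb t) x ^ spinCount τ (-1) * siteGen t σ x) := by
    intro x; push_cast; ring
  simp_rw [Nat.succ_eq_add_one, hInt]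
  rw [MeasureTheory.integral_const_mul, wrPrefactor, siteIntegral, fieldIntegral]
  push_cast
  ring

lemma isingWeightT_cons {βI t : ℝ} (hβ : 0 < βI) {N : ℕ} (σ : ISpin) (τ : Fin N → ISpin) :
    isingWeightT βI t (Fin.cons σ τ : Fin (N + 1) → ISpin) =
      ((2 : ℝ) ^ (-((N + 1 : ℕ) : ℤ)) * (√(π / (1 / (2 * βI) * (N + 1))))⁻¹) *
      siteIntegral t (1 / (2 * βI)) (N + 1) (spinCount τ 1) (spinCount τ (-1)) σ := by
  rw [isingWeightT_eq hβ N.succ_pos]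
  simp only [Fin.prod_univ_succ, Fin.cons_zero, Fin.cons_succ]
  have hprod : ∀ x, ∏ i, siteGen t (τ i) x =
      spinGen (stayProb t) (flipProb t) x ^ spinCount τ 1 *
          spinGen (flipProb t) (stayProb t) x ^ spinCount τ (-1) := by
    intro x
    rw [prod_eq_prod_pow_spinCount τ fun s => siteGen t s x]
    simp [ISpin, siteGen, mul_comm]
  have hInt : ∀ x, exp (-(1 / (2 * βI) * ((N + 1 : ℕ) : ℝ)) * x ^ 2) *
      (siteGen t σ x * ∏ i, siteGen t (τ i) x) =
      exp (-(1 / (2 * βI) * ((N : ℝ) + 1)) * x ^ 2) *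
          spinGen (stayProb t) (flipProb t) x ^ spinCount τ 1 *
          spinGen (flipProb t) (stayProb t) x ^ spinCount τ (-1) * siteGen t σ x := by
    intro x; rw [hprod]; push_cast; ring
  simp_rw [Nat.succ_eq_add_one, hInt]
  rw [siteIntegral, fieldIntegral]
  push_cast
  ring

/-! ### Site averages -/

lemma siteIntegral_zero_pos {t c M : ℝ} (ht : 0 < t) (hc : 0 < c) (hM : 0 < M) (k l : ℕ) :
    0 < siteIntegral t c M k l 0 := by
  have hb := flipProb_pos ht
  rw [siteIntegral, siteGen_zero]
  exact fieldIntegral_one_pos (hb.trans (flipProb_lt_stayProb t)) hb (stayProb_add_flipProb t)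
    hc hM k l

lemma two_mul_siteIntegral_zero_le {t c M : ℝ} (ht : 0 < t) (hc : 0 < c) (hM : 0 < M) (k l : ℕ) :
    2 * siteIntegral t c M k l 0 ≤ siteIntegral t c M k l 1 + siteIntegral t c M k l (-1) := by
  have hb := flipProb_pos ht
  have ha := hb.trans (flipProb_lt_stayProb t)
  have hab := stayProb_add_flipProb t
  have hInt := fun s => integrable_fieldDensity_mul ha hb hab hc hM k l (continuous_siteGen t s)
    (abs_siteGen_le ht s)
  unfold siteIntegral fieldIntegral
  rw [← MeasureTheory.integral_const_mul, ← MeasureTheory.integral_add (hInt 1) (hInt (-1))]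
  refine MeasureTheory.integral_mono ((hInt 0).const_mul 2) ((hInt 1).add (hInt (-1))) fun x => ?_
  have p1 := spinGen_pos ha hb x
  have p2 := spinGen_pos hb ha x
  have hsum : 2 ≤ siteGen t 1 x + siteGen t (-1) x := by
    rw [siteGen_one, siteGen_neg_one]
    have e : spinGen (stayProb t) (flipProb t) x + spinGen (flipProb t) (stayProb t) x =
        exp x + exp (-x) := by
      calc _ = (stayProb t + flipProb t) * (exp x + exp (-x)) := by unfold spinGen; ring
        _ = _ := by rw [hab, one_mul]
    rw [e]
    linarith [add_one_le_exp x, add_one_le_exp (-x)]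
  simp only [siteGen_zero, mul_one]
  rw [← mul_add, mul_comm 2]
  gcongr

lemma tendsto_siteAverage {t c p q : ℝ} (ht : 0 < t) (hc : 0 < c) {k l : ℕ → ℕ}
    (hk : Tendsto (fun N : ℕ => (k N : ℝ) / N) atTop (𝓝 p))
    (hl : Tendsto (fun N : ℕ => (l N : ℝ) / N) atTop (𝓝 q))
    (huniq : UniqueGlobalMax (fieldRate (stayProb t) (flipProb t) c p q)) {x₀ : ℝ}
    (hx₀ : IsGlobalMax (fieldRate (stayProb t) (flipProb t) c p q) x₀) (s : ℤ) :
    Tendsto (fun N : ℕ => siteIntegral t c (N + 1) (k N) (l N) s /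
      siteIntegral t c (N + 1) (k N) (l N) 0) atTop (𝓝 (siteGen t s x₀)) := by
  have hb := flipProb_pos ht
  have := tendsto_fieldAverage (hb.trans (flipProb_lt_stayProb t)) hb (stayProb_add_flipProb t)
    hc (tendsto_div_succ_iff.2 hk) (tendsto_div_succ_iff.2 hl) huniq hx₀
    (continuous_siteGen t s) (abs_siteGen_le ht s)
  simpa only [siteIntegral, siteGen_zero] using this

/-- If the maximizer is not unique, two sequences of boundary conditions with the same limit
separate the relative weights of plus and minus at an additional site. -/
lemma exists_separating_counts {t c p q : ℝ} (ht : 0 < t) (hc : 0 < c) (hp : 0 ≤ p) (hq : 0 ≤ q)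
    (hnu : ¬ UniqueGlobalMax (fieldRate (stayProb t) (flipProb t) c p q)) :
    ∃ A₁ B₁ A₂ B₂ : ℝ, 0 < B₁ ∧ 0 < B₂ ∧ 0 < A₁ ∧ A₁ * B₂ < A₂ * B₁ ∧
      (∃ k l : ℕ → ℕ, (∀ N : ℕ, k N + l N = ⌊(p + q) * N⌋₊) ∧
        Tendsto (fun N : ℕ => (k N : ℝ) / N) atTop (𝓝 p) ∧
        Tendsto (fun N : ℕ => (l N : ℝ) / N) atTop (𝓝 q) ∧
        ∀ᶠ N : ℕ in atTop, A₂ * siteIntegral t c (N + 1) (k N) (l N) (-1) ≤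
          B₂ * siteIntegral t c (N + 1) (k N) (l N) 1) ∧
      (∃ k l : ℕ → ℕ, (∀ N : ℕ, k N + l N = ⌊(p + q) * N⌋₊) ∧
        Tendsto (fun N : ℕ => (k N : ℝ) / N) atTop (𝓝 p) ∧
        Tendsto (fun N : ℕ => (l N : ℝ) / N) atTop (𝓝 q) ∧
        ∀ᶠ N : ℕ in atTop, B₁ * siteIntegral t c (N + 1) (k N) (l N) 1 ≤
          A₁ * siteIntegral t c (N + 1) (k N) (l N) (-1)) := by
  have hb := flipProb_pos ht
  have hba := flipProb_lt_stayProb t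
  have ha := hb.trans hba
  have hab := stayProb_add_flipProb t
  have hp : 0 < p := hp.lt_of_ne fun h => hnu <| by
    rw [← h]; exact (uniqueGlobalMax_fieldRate_zero_right hb hba hc hq).fieldRate_swap
  have hq : 0 < q := hq.lt_of_ne fun h => hnu <| by
    rw [← h]; exact uniqueGlobalMax_fieldRate_zero_right hb hba hc hp.le
  obtain ⟨x₁, x₂, hx₁, hx₂, hlt⟩ : ∃ x₁ x₂,
      IsGlobalMax (fieldRate (stayProb t) (flipProb t) c p q) x₁ ∧
      IsGlobalMax (fieldRate (stayProb t) (flipProb t) c p q) x₂ ∧ x₁ < x₂ := by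
    unfold UniqueGlobalMax at hnu
    push Not at hnu
    obtain ⟨x, y, hx, hy, hne⟩ := hnu
    rcases hne.lt_or_gt with h | h
    exacts [⟨x, y, hx, hy, h⟩, ⟨y, x, hy, hx, h⟩]
  set a := stayProb t
  set b := flipProb t
  obtain ⟨y₁, hy₁, hy₁₂⟩ := exists_between hlt
  obtain ⟨y₂, hy₂, hy₂₂⟩ := exists_between hy₁₂
  have hbound : ∀ u v x, |u * siteGen t 1 x + v * siteGen t (-1) x| ≤ (|u| + |v|) * exp |x| := by
    intro u v x
    have h1 := abs_siteGen_le ht 1 x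
    have h2 := abs_siteGen_le ht (-1) x
    rw [one_mul] at h1 h2
    calc _ ≤ |u * siteGen t 1 x| + |v * siteGen t (-1) x| := abs_add_le _ _
      _ = |u| * |siteGen t 1 x| + |v| * |siteGen t (-1) x| := by rw [abs_mul, abs_mul]
      _ ≤ |u| * exp |x| + |v| * exp |x| := by gcongr
      _ = _ := by ring
  have hcont : ∀ u v, Continuous fun x => u * siteGen t 1 x + v * siteGen t (-1) x := by
    intro u v
    have h1 := continuous_siteGen t 1
    have h2 := continuous_siteGen t (-1)
    fun_prop
  have hlin : ∀ (u v : ℝ) (N k l : ℕ), fieldIntegral a b c (N + 1) k l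
      (fun x => u * siteGen t 1 x + v * siteGen t (-1) x) =
      u * siteIntegral t c (N + 1) k l 1 + v * siteIntegral t c (N + 1) k l (-1) :=
    fun u v N k l => fieldIntegral_linear ha hb hab hc (by positivity) k l
      (continuous_siteGen t 1) (continuous_siteGen t (-1)) (abs_siteGen_le ht 1)
      (abs_siteGen_le ht (-1)) u v
  refine ⟨spinGen a b y₁, spinGen b a y₁, spinGen a b y₂, spinGen b a y₂, spinGen_pos hb ha _,
    spinGen_pos hb ha _, spinGen_pos ha hb _, spinGen_mul_lt hb hba hy₂, ?_, ?_⟩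
  · obtain ⟨k, l, hkl, hk, hl, hev⟩ := exists_tilted_counts hb hba hab hc hp hq hx₂ (Or.inl rfl)
      (hcont (spinGen b a y₂) (-spinGen a b y₂)) (hbound _ _) (fun x hx => by
        have := spinGen_mul_lt hb hba (show y₂ < x by linarith)
        rw [siteGen_one, siteGen_neg_one]
        linarith)
    refine ⟨k, l, hkl, hk, hl, hev.mono fun N hN => ?_⟩
    rw [hlin] at hN
    linarith
  · obtain ⟨k, l, hkl, hk, hl, hev⟩ := exists_tilted_counts hb hba hab hc hp hq hx₁ (Or.inr rfl)
      (hcont (-spinGen b a y₁) (spinGen a b y₁)) (hbound _ _) (fun x hx => by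
        have := spinGen_mul_lt hb hba (show x < y₁ by linarith)
        rw [siteGen_one, siteGen_neg_one]
        linarith)
    refine ⟨k, l, hkl, hk, hl, hev.mono fun N hN => ?_⟩
    rw [hlin] at hN
    linarith

lemma add_nonpos_of_separated {A₁ B₁ A₂ B₂ u v : ℝ} (hB₁ : 0 < B₁) (hB₂ : 0 < B₂) (hA₁ : 0 < A₁)
    (h : A₁ * B₂ < A₂ * B₁) (h1 : A₂ * v ≤ B₂ * u) (h2 : B₁ * u ≤ A₁ * v) : u + v ≤ 0 := by
  have h3 : (A₂ * B₁ - A₁ * B₂) * v ≤ 0 := by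
    nlinarith [mul_le_mul_of_nonneg_left h1 hB₁.le, mul_le_mul_of_nonneg_left h2 hB₂.le]
  have hv : v ≤ 0 := nonpos_of_mul_nonpos_right h3 (by linarith)
  have hu : u ≤ 0 :=
    nonpos_of_mul_nonpos_right (h2.trans (mul_nonpos_of_nonneg_of_nonpos hA₁.le hv)) hB₁
  linarith

/-! ### Configurations with prescribed counts -/

lemma exists_spin_config {N k l : ℕ} (h : k + l ≤ N) :
    ∃ τ : Fin N → Spin, spinCount τ 1 = k ∧ spinCount τ (-1) = l ∧
      spinCount τ 0 = N - (k + l) := by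
  let τ : Fin N → Spin := fun i => if (i : ℕ) < k then ⟨1, by decide⟩
    else if (i : ℕ) < k + l then ⟨-1, by decide⟩ else ⟨0, by decide⟩
  have h1 : spinCount τ 1 = k := by
    have : (univ.filter fun i : Fin N => (τ i : ℤ) = 1) =
        univ.filter fun i : Fin N => (i : ℕ) < k := by
      ext i; simp only [Finset.mem_filter, Finset.mem_univ, true_and, τ]
      split_ifs <;> simp_all
    rw [spinCount, this, Fin.card_filter_val_lt]; omega
  have h0 : spinCount τ 0 = N - (k + l) := by
    have : (univ.filter fun i : Fin N => (τ i : ℤ) = 0) =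
        univ.filter fun i : Fin N => ¬ (i : ℕ) < k + l := by
      ext i; simp only [Finset.mem_filter, Finset.mem_univ, true_and, τ]
      split_ifs <;> simp_all <;> omega
    have hc := Finset.card_filter_add_card_filter_not (s := (univ : Finset (Fin N)))
      (fun i => (i : ℕ) < k + l)
    rw [Fin.card_filter_val_lt, Finset.card_univ, Fintype.card_fin] at hc
    rw [spinCount, this]; omega
  refine ⟨τ, h1, ?_, h0⟩
  have hs := sum_eq_sum_spinCount_mul τ fun _ => 1
  simp [Spin] at hs
  have hs' : N = spinCount τ (-1) + (spinCount τ 0 + spinCount τ 1) := by exact_mod_cast hs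
  omega

lemma exists_iSpin_config {N k l : ℕ} (h : k + l = N) :
    ∃ τ : Fin N → ISpin, spinCount τ 1 = k ∧ spinCount τ (-1) = l := by
  let τ : Fin N → ISpin := fun i => if (i : ℕ) < k then ⟨1, by decide⟩ else ⟨-1, by decide⟩
  have h1 : spinCount τ 1 = k := by
    have : (univ.filter fun i : Fin N => (τ i : ℤ) = 1) =
        univ.filter fun i : Fin N => (i : ℕ) < k := by
      ext i; simp only [Finset.mem_filter, Finset.mem_univ, true_and, τ]
      split_ifs <;> simp_all
    rw [spinCount, this, Fin.card_filter_val_lt]; omega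
  refine ⟨τ, h1, ?_⟩
  have hs := sum_eq_sum_spinCount_mul τ fun _ => 1
  simp [ISpin] at hs
  have hs' : N = spinCount τ (-1) + spinCount τ 1 := by exact_mod_cast hs
  omega

/-! ### Characterization of bad points by non-uniqueness of the maximizer -/

/-- Relative conditional weight of a spin `s` in the Widom-Rowlinson model. -/
noncomputable def wrRelWeight (β : ℝ) (α : ℤ → ℝ) (t : ℝ) {N : ℕ} (τ : Fin N → Spin)
    (s : ℤ) : ℝ :=
  exp (-(β * (((s : ℝ) ^ 2) ^ 2 + 2 * (s : ℝ) ^ 2 * (spinCount τ 1 + spinCount τ (-1))) /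
      (4 * ((N : ℝ) + 1)))) * α s *
    (siteIntegral t (1 / β) (N + 1) (spinCount τ 1) (spinCount τ (-1)) s /
      siteIntegral t (1 / β) (N + 1) (spinCount τ 1) (spinCount τ (-1)) 0)

lemma wrCondProbT_eq {β t : ℝ} (hβ : 0 < β) (ht : 0 < t) {α : ℤ → ℝ} (hsym : α 1 = α (-1))
    (hα : ∀ s ∈ Spin, 0 < α s) {N : ℕ} (σ : Spin) (τ : Fin N → Spin) :
    wrCondProbT β α t σ τ =
      wrRelWeight β α t τ σ / ∑ σ' : Spin, wrRelWeight β α t τ σ' := by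
  set n : ℝ := spinCount τ 1 + spinCount τ (-1) with hn
  have hJ := siteIntegral_zero_pos ht (one_div_pos.2 hβ) (by positivity : (0 : ℝ) < N + 1)
    (spinCount τ 1) (spinCount τ (-1))
  set K := wrPrefactor β α τ * exp (-(β * n ^ 2 / (4 * ((N : ℝ) + 1)))) *
    siteIntegral t (1 / β) (N + 1) (spinCount τ 1) (spinCount τ (-1)) 0
  have hK : K ≠ 0 := (mul_pos (mul_pos (wrPrefactor_pos hβ hα τ) (exp_pos _)) hJ).ne'
  have hw : ∀ s : Spin, wrWeightT β α t (Fin.cons s τ : Fin (N + 1) → Spin) =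
      K * wrRelWeight β α t τ s := by
    intro s
    rw [wrWeightT_cons hβ hsym, wrRelWeight, ← hn]
    have e : exp (-(β * (((s : ℤ) : ℝ) ^ 2 + n) ^ 2 / (4 * ((N : ℝ) + 1)))) =
        exp (-(β * n ^ 2 / (4 * ((N : ℝ) + 1)))) *
        exp (-(β * ((((s : ℤ) : ℝ) ^ 2) ^ 2 + 2 * ((s : ℤ) : ℝ) ^ 2 * n) /
          (4 * ((N : ℝ) + 1)))) := by
      rw [← exp_add]; congr 1; ring
    rw [e]
    simp only [K]
    field_simp
  unfold wrCondProbT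
  simp_rw [hw, ← Finset.mul_sum]
  exact mul_div_mul_left _ _ hK

lemma wrRelWeight_zero {β t : ℝ} (hβ : 0 < β) (ht : 0 < t) (α : ℤ → ℝ) {N : ℕ}
    (τ : Fin N → Spin) : wrRelWeight β α t τ 0 = α 0 := by
  have hJ := siteIntegral_zero_pos ht (one_div_pos.2 hβ) (by positivity : (0 : ℝ) < N + 1)
    (spinCount τ 1) (spinCount τ (-1))
  rw [wrRelWeight, div_self hJ.ne']
  simp

/-- The relative weights of plus and minus are a common factor times the site integrals. -/
lemma exists_wrRelWeight_eq {β t : ℝ} (hβ : 0 < β) (ht : 0 < t) {α : ℤ → ℝ}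
    (hsym : α 1 = α (-1)) (h1 : 0 < α 1) {N : ℕ} (τ : Fin N → Spin) :
    ∃ κ : ℝ, 0 ≤ κ ∧
      wrRelWeight β α t τ 1 =
        κ * siteIntegral t (1 / β) (N + 1) (spinCount τ 1) (spinCount τ (-1)) 1 ∧
      wrRelWeight β α t τ (-1) =
        κ * siteIntegral t (1 / β) (N + 1) (spinCount τ 1) (spinCount τ (-1)) (-1) := by
  have hJ := siteIntegral_zero_pos ht (one_div_pos.2 hβ) (by positivity : (0 : ℝ) < N + 1)
    (spinCount τ 1) (spinCount τ (-1))
  refine ⟨exp (-(β * (1 + 2 * (spinCount τ 1 + spinCount τ (-1))) / (4 * ((N : ℝ) + 1)))) * α 1 /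
    siteIntegral t (1 / β) (N + 1) (spinCount τ 1) (spinCount τ (-1)) 0, by positivity, ?_, ?_⟩
  · simp only [wrRelWeight]; norm_num; ring
  · simp only [wrRelWeight, ← hsym]; norm_num; ring

lemma spinCount_add_le {N : ℕ} (τ : Fin N → Spin) :
    spinCount τ 1 + spinCount τ (-1) ≤ N := by
  have hs := sum_eq_sum_spinCount_mul τ fun _ => 1
  simp [Spin] at hs
  have hs' : N = spinCount τ (-1) + (spinCount τ 0 + spinCount τ 1) := by exact_mod_cast hs
  omega

lemma le_wrRelWeight_add {β t : ℝ} (hβ : 0 < β) (ht : 0 < t) {α : ℤ → ℝ}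
    (hsym : α 1 = α (-1)) (h1 : 0 < α 1) {N : ℕ} (τ : Fin N → Spin) :
    2 * exp (-(β / 2)) * α 1 ≤ wrRelWeight β α t τ 1 + wrRelWeight β α t τ (-1) := by
  set k := spinCount τ 1 with hk
  set l := spinCount τ (-1) with hl
  have hJ := siteIntegral_zero_pos ht (one_div_pos.2 hβ) (by positivity : (0 : ℝ) < N + 1) k l
  have hJ2 := two_mul_siteIntegral_zero_le ht (one_div_pos.2 hβ)
    (by positivity : (0 : ℝ) < N + 1) k l
  have hkl : (k : ℝ) + l ≤ N := by exact_mod_cast spinCount_add_le τ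
  have e : wrRelWeight β α t τ 1 + wrRelWeight β α t τ (-1) =
      exp (-(β * (1 + 2 * ((k : ℝ) + l)) / (4 * ((N : ℝ) + 1)))) * α 1 *
        ((siteIntegral t (1 / β) (N + 1) k l 1 + siteIntegral t (1 / β) (N + 1) k l (-1)) /
          siteIntegral t (1 / β) (N + 1) k l 0) := by
    simp only [wrRelWeight, ← hsym, ← hk, ← hl]; norm_num; ring
  rw [e, mul_comm (2 : ℝ), mul_right_comm]
  have hr : 2 ≤ (siteIntegral t (1 / β) (N + 1) k l 1 + siteIntegral t (1 / β) (N + 1) k l (-1)) /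
      siteIntegral t (1 / β) (N + 1) k l 0 := by rwa [le_div_iff₀ hJ]
  have hexp : exp (-(β / 2)) ≤ exp (-(β * (1 + 2 * ((k : ℝ) + l)) / (4 * ((N : ℝ) + 1)))) := by
    refine exp_le_exp.2 (neg_le_neg ?_)
    rw [div_le_div_iff₀ (by positivity) two_pos]
    nlinarith
  exact mul_le_mul (mul_le_mul_of_nonneg_right hexp h1.le) hr two_pos.le (by positivity)

lemma tendsto_wrRelWeight {β t : ℝ} (hβ : 0 < β) (ht : 0 < t) (α : ℤ → ℝ) {ν : ℤ → ℝ}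
    (huniq : UniqueGlobalMax (fieldRate (stayProb t) (flipProb t) (1 / β) (ν 1) (ν (-1))))
    {x₀ : ℝ} (hx₀ : IsGlobalMax (fieldRate (stayProb t) (flipProb t) (1 / β) (ν 1) (ν (-1))) x₀)
    {τ : (N : ℕ) → Fin N → Spin} (hτ : EmpConv τ ν) (s : ℤ) :
    Tendsto (fun N : ℕ => wrRelWeight β α t (τ N) s) atTop
      (𝓝 (exp (-(β * (s : ℝ) ^ 2 * (ν 1 + ν (-1)) / 2)) * α s * siteGen t s x₀)) := by
  have hk : Tendsto (fun N : ℕ => (spinCount (τ N) 1 : ℝ) / N) atTop (𝓝 (ν 1)) := hτ 1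
  have hl : Tendsto (fun N : ℕ => (spinCount (τ N) (-1) : ℝ) / N) atTop (𝓝 (ν (-1))) := hτ (-1)
  refine Tendsto.mul (Tendsto.mul_const _ ?_)
    (tendsto_siteAverage ht (one_div_pos.2 hβ) hk hl huniq hx₀ s)
  refine (continuous_exp.tendsto _).comp (Tendsto.neg ?_)
  have h1 := ((tendsto_div_succ_iff.2 hk).add (tendsto_div_succ_iff.2 hl)).const_mul
    (β * (s : ℝ) ^ 2 / 2)
  have h2 := (tendsto_one_div_add_atTop_nhds_zero_nat (𝕜 := ℝ)).const_mul
    (β * ((s : ℝ) ^ 2) ^ 2 / 4)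
  have h3 := h2.add h1
  rw [mul_zero, zero_add, show β * (s : ℝ) ^ 2 / 2 * (ν 1 + ν (-1)) =
    β * (s : ℝ) ^ 2 * (ν 1 + ν (-1)) / 2 by ring] at h3
  refine h3.congr fun N => ?_
  have : (N : ℝ) + 1 ≠ 0 := by positivity
  field_simp
  ring

lemma empConv_of_counts {ν : ℤ → ℝ} (hν : IsProbVec ν) {τ : (N : ℕ) → Fin N → Spin}
    {k l : ℕ → ℕ} (hkl : ∀ N, k N + l N ≤ N)
    (hτ : ∀ N, spinCount (τ N) 1 = k N ∧ spinCount (τ N) (-1) = l N ∧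
      spinCount (τ N) 0 = N - (k N + l N))
    (hk : Tendsto (fun N : ℕ => (k N : ℝ) / N) atTop (𝓝 (ν 1)))
    (hl : Tendsto (fun N : ℕ => (l N : ℝ) / N) atTop (𝓝 (ν (-1)))) : EmpConv τ ν := by
  have hsum : ν 0 = 1 - (ν 1 + ν (-1)) := by
    have := hν.2.2
    simp [Spin] at this
    linarith
  intro s
  change Tendsto (fun N : ℕ => (spinCount (τ N) s : ℝ) / N) atTop (𝓝 (ν s))
  by_cases hs : s ∈ Spin
  · rcases spin_cases ⟨s, hs⟩ with h | h | h <;> simp only at h <;> subst h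
    · simpa only [(hτ _).2.1] using hl
    · rw [hsum]
      refine ((hk.add hl).const_sub 1).congr' ?_
      filter_upwards [eventually_gt_atTop 0] with N hN
      have : (N : ℝ) ≠ 0 := by positivity
      rw [(hτ N).2.2, Nat.cast_sub (hkl N)]
      push_cast
      field_simp
    · simpa only [(hτ _).1] using hk
  · have h0 : ∀ N, spinCount (τ N) s = 0 := by
      intro N
      rw [spinCount, Finset.card_eq_zero, Finset.filter_eq_empty_iff]
      rintro i - rfl
      exact hs (τ N i).2
    simp [h0, hν.2.1 s hs]

lemma isBadMeasure_iff {β t : ℝ} (hβ : 0 < β) (ht : 0 < t) {α : ℤ → ℝ} (hsym : α 1 = α (-1))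
    (h1 : 0 < α 1) (h0 : 0 < α 0) {ν : ℤ → ℝ} (hν : IsProbVec ν) :
    IsBadMeasure β α t ν ↔
      ¬ UniqueGlobalMax (fieldRate (stayProb t) (flipProb t) (1 / β) (ν 1) (ν (-1))) := by
  have hb := flipProb_pos ht
  have ha := hb.trans (flipProb_lt_stayProb t)
  have hab := stayProb_add_flipProb t
  have hc : 0 < 1 / β := one_div_pos.2 hβ
  have hα : ∀ s ∈ Spin, 0 < α s := by
    intro s hs
    rcases spin_cases ⟨s, hs⟩ with h | h | h <;> simp only at h <;> subst h
    exacts [hsym ▸ h1, h0, h1]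
  constructor
  · rintro ⟨τ, τ', hτ, hτ', σ, hbad⟩ huniq
    obtain ⟨x₀, hx₀⟩ := exists_isGlobalMax_fieldRate ha hb hab hc (ν 1) (ν (-1))
    set v : ℤ → ℝ := fun s =>
      exp (-(β * (s : ℝ) ^ 2 * (ν 1 + ν (-1)) / 2)) * α s * siteGen t s x₀
    have hv : ∀ s : Spin, 0 < v s := fun s =>
      mul_pos (mul_pos (exp_pos _) (hα s s.2)) (siteGen_pos ht s x₀)
    have hlim : ∀ ρ : (N : ℕ) → Fin N → Spin, EmpConv ρ ν →
        Tendsto (fun N : ℕ => wrCondProbT β α t σ (ρ N)) atTop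
          (𝓝 (v σ / ∑ σ' : Spin, v σ')) := by
      intro ρ hρ
      simp_rw [wrCondProbT_eq hβ ht hsym hα]
      refine (tendsto_wrRelWeight hβ ht α huniq hx₀ hρ σ).div
        (tendsto_finsetSum _ fun σ' _ => tendsto_wrRelWeight hβ ht α huniq hx₀ hρ σ') ?_
      exact (Finset.sum_pos (fun s _ => hv s) ⟨σ, Finset.mem_univ _⟩).ne'
    exact hbad ⟨_, hlim τ hτ, hlim τ' hτ'⟩
  · intro hnu
    obtain ⟨A₁, B₁, A₂, B₂, hB₁, hB₂, hA₁, hAB, ⟨k, l, hkl, hk, hl, hev⟩,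
      ⟨k', l', hkl', hk', hl', hev'⟩⟩ :=
      exists_separating_counts ht hc (hν.1 1) (hν.1 (-1)) hnu
    have hle1 : ν 1 + ν (-1) ≤ 1 := by
      have h2 := hν.2.2
      simp [Spin] at h2
      linarith [hν.1 0]
    have hfloor : ∀ N : ℕ, ⌊(ν 1 + ν (-1)) * N⌋₊ ≤ N := fun N => by
      refine Nat.floor_le_of_le ?_
      exact mul_le_of_le_one_left (Nat.cast_nonneg N) hle1
    choose τ hτ using fun N => exists_spin_config ((hkl N).trans_le (hfloor N))
    choose τ' hτ' using fun N => exists_spin_config ((hkl' N).trans_le (hfloor N))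
    by_contra hgood
    unfold IsBadMeasure at hgood
    push Not at hgood
    have hL := hgood τ τ'
      (empConv_of_counts hν (fun N => (hkl N).trans_le (hfloor N)) hτ hk hl)
      (empConv_of_counts hν (fun N => (hkl' N).trans_le (hfloor N)) hτ' hk' hl')
    obtain ⟨u, hu, hu'⟩ := hL ⟨1, by decide⟩
    obtain ⟨v, hv, hv'⟩ := hL ⟨-1, by decide⟩
    simp_rw [wrCondProbT_eq hβ ht hsym hα, sum_spin, wrRelWeight_zero hβ ht]
      at hu hu' hv hv'
    set κ := 2 * exp (-(β / 2)) * α 1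
    have hκ : 0 < κ := by positivity
    have hden : ∀ {N : ℕ} (ρ : Fin N → Spin),
        0 < wrRelWeight β α t ρ (-1) + α 0 + wrRelWeight β α t ρ 1 := fun ρ => by
      linarith [le_wrRelWeight_add hβ ht hsym h1 ρ]
    have hpos : κ / (κ + α 0) ≤ u + v := by
      refine ge_of_tendsto' (hu.add hv) fun N => ?_
      rw [← add_div, div_le_div_iff₀ (by positivity) (hden (τ N))]
      nlinarith [le_wrRelWeight_add hβ ht hsym h1 (τ N)]
    have hr1 : A₂ * v ≤ B₂ * u := by
      refine le_of_tendsto_of_tendsto (hv.const_mul A₂) (hu.const_mul B₂) ?_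
      filter_upwards [hev] with N hN
      rw [← (hτ N).1, ← (hτ N).2.1] at hN
      obtain ⟨w, hw, e1, e2⟩ := exists_wrRelWeight_eq hβ ht hsym h1 (τ N)
      have := hden (τ N)
      rw [← mul_div_assoc, ← mul_div_assoc]
      refine div_le_div_of_nonneg_right ?_ this.le
      rw [e1, e2]
      linarith [mul_le_mul_of_nonneg_left hN hw]
    have hr2 : B₁ * u ≤ A₁ * v := by
      refine le_of_tendsto_of_tendsto (hu'.const_mul B₁) (hv'.const_mul A₁) ?_
      filter_upwards [hev'] with N hN
      rw [← (hτ' N).1, ← (hτ' N).2.1] at hN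
      obtain ⟨w, hw, e1, e2⟩ := exists_wrRelWeight_eq hβ ht hsym h1 (τ' N)
      have := hden (τ' N)
      rw [← mul_div_assoc, ← mul_div_assoc]
      refine div_le_div_of_nonneg_right ?_ this.le
      rw [e1, e2]
      linarith [mul_le_mul_of_nonneg_left hN hw]
    have := add_nonpos_of_separated hB₁ hB₂ hA₁ hAB hr1 hr2
    have : 0 < κ / (κ + α 0) := by positivity
    linarith

lemma isingCondProbT_eq {βI t : ℝ} (hβ : 0 < βI) {N : ℕ} (σ : ISpin) (τ : Fin N → ISpin) :
    isingCondProbT βI t σ τ =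
      siteIntegral t (1 / (2 * βI)) (N + 1) (spinCount τ 1) (spinCount τ (-1)) σ /
      (siteIntegral t (1 / (2 * βI)) (N + 1) (spinCount τ 1) (spinCount τ (-1)) (-1) +
        siteIntegral t (1 / (2 * βI)) (N + 1) (spinCount τ 1) (spinCount τ (-1)) 1) := by
  unfold isingCondProbT
  simp_rw [isingWeightT_cons hβ]
  rw [← Finset.mul_sum, sum_iSpin, mul_div_mul_left]
  have : (0 : ℝ) < √(π / (1 / (2 * βI) * (N + 1))) := Real.sqrt_pos.2 (by positivity)
  positivity

lemma sum_iSpin_eq_spinCount {N : ℕ} (τ : Fin N → ISpin) :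
    ∑ i, ((τ i : ℤ) : ℝ) = spinCount τ 1 - spinCount τ (-1) ∧
      (spinCount τ 1 : ℝ) + spinCount τ (-1) = N := by
  have h1 := sum_eq_sum_spinCount_mul τ fun s => (s : ℝ)
  have h2 := sum_eq_sum_spinCount_mul τ fun _ => 1
  simp [ISpin] at h1 h2
  constructor <;> linarith

lemma tendsto_spinCount_of_magnetization {p q : ℝ} (hpq : p + q = 1)
    {τ : (N : ℕ) → Fin N → ISpin}
    (hτ : Tendsto (fun N : ℕ => (∑ i : Fin N, ((τ N i : ℤ) : ℝ)) / N) atTop (𝓝 (p - q))) :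
    Tendsto (fun N : ℕ => (spinCount (τ N) 1 : ℝ) / N) atTop (𝓝 p) ∧
      Tendsto (fun N : ℕ => (spinCount (τ N) (-1) : ℝ) / N) atTop (𝓝 q) := by
  have h1 := (hτ.const_add 1).div_const 2
  have h2 := (hτ.const_sub 1).div_const 2
  rw [show (1 + (p - q)) / 2 = p by linarith] at h1
  rw [show (1 - (p - q)) / 2 = q by linarith] at h2
  refine ⟨h1.congr' ?_, h2.congr' ?_⟩ <;>
  · filter_upwards [eventually_gt_atTop 0] with N hN
    have : (N : ℝ) ≠ 0 := by positivity
    obtain ⟨e1, e2⟩ := sum_iSpin_eq_spinCount (τ N)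
    rw [e1]
    field_simp
    linarith

lemma isBadMagnetization_iff {βI t p q : ℝ} (hβ : 0 < βI) (ht : 0 < t) (hp : 0 ≤ p) (hq : 0 ≤ q)
    (hpq : p + q = 1) :
    IsBadMagnetization βI t (p - q) ↔
      ¬ UniqueGlobalMax (fieldRate (stayProb t) (flipProb t) (1 / (2 * βI)) p q) := by
  have hb := flipProb_pos ht
  have ha := hb.trans (flipProb_lt_stayProb t)
  have hab := stayProb_add_flipProb t
  have hc : 0 < 1 / (2 * βI) := by positivity
  constructor
  · rintro ⟨τ, τ', hτ, hτ', σ, hbad⟩ huniq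
    obtain ⟨x₀, hx₀⟩ := exists_isGlobalMax_fieldRate ha hb hab hc p q
    have hlim : ∀ ρ : (N : ℕ) → Fin N → ISpin,
        Tendsto (fun N : ℕ => (∑ i : Fin N, ((ρ N i : ℤ) : ℝ)) / N) atTop (𝓝 (p - q)) →
        Tendsto (fun N : ℕ => isingCondProbT βI t σ (ρ N)) atTop
          (𝓝 (siteGen t σ x₀ / (siteGen t (-1) x₀ + siteGen t 1 x₀))) := by
      intro ρ hρ
      obtain ⟨hk, hl⟩ := tendsto_spinCount_of_magnetization hpq hρ
      have havg := tendsto_siteAverage ht hc hk hl huniq hx₀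
      have hne : siteGen t (-1) x₀ + siteGen t 1 x₀ ≠ 0 :=
        (add_pos (siteGen_pos ht _ _) (siteGen_pos ht _ _)).ne'
      refine ((havg σ).div ((havg (-1)).add (havg 1)) hne).congr fun N => ?_
      have hJ := siteIntegral_zero_pos ht hc (by positivity : (0 : ℝ) < N + 1)
        (spinCount (ρ N) 1) (spinCount (ρ N) (-1))
      rw [isingCondProbT_eq hβ, Pi.div_apply, ← add_div, div_div_div_cancel_right₀ hJ.ne']
    exact hbad ⟨_, hlim τ hτ, hlim τ' hτ'⟩
  · intro hnu
    obtain ⟨A₁, B₁, A₂, B₂, hB₁, hB₂, hA₁, hAB, ⟨k, l, hkl, hk, hl, hev⟩,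
      ⟨k', l', hkl', hk', hl', hev'⟩⟩ := exists_separating_counts ht hc hp hq hnu
    simp only [hpq, one_mul, Nat.floor_natCast] at hkl hkl'
    choose τ hτ using fun N => exists_iSpin_config (hkl N)
    choose τ' hτ' using fun N => exists_iSpin_config (hkl' N)
    by_contra hgood
    unfold IsBadMagnetization at hgood
    push Not at hgood
    have hL := hgood τ τ'
      ((hk.sub hl).congr fun N => by
        rw [(sum_iSpin_eq_spinCount (τ N)).1, (hτ N).1, (hτ N).2, sub_div])
      ((hk'.sub hl').congr fun N => by
        rw [(sum_iSpin_eq_spinCount (τ' N)).1, (hτ' N).1, (hτ' N).2, sub_div])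
    obtain ⟨u, hu, hu'⟩ := hL ⟨1, by decide⟩
    obtain ⟨v, hv, hv'⟩ := hL ⟨-1, by decide⟩
    simp_rw [isingCondProbT_eq hβ, (hτ _).1, (hτ _).2] at hu hv
    simp_rw [isingCondProbT_eq hβ, (hτ' _).1, (hτ' _).2] at hu' hv'
    have hden : ∀ N k l : ℕ, 0 < siteIntegral t (1 / (2 * βI)) (N + 1) k l (-1) +
        siteIntegral t (1 / (2 * βI)) (N + 1) k l 1 := fun N k l => by
      have hM : (0 : ℝ) < N + 1 := by positivity
      linarith [siteIntegral_zero_pos ht hc hM k l, two_mul_siteIntegral_zero_le ht hc hM k l]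
    have hone : u + v = 1 := by
      refine tendsto_nhds_unique (hu.add hv) (tendsto_const_nhds.congr fun N => ?_)
      rw [← add_div, add_comm (siteIntegral _ _ _ _ _ 1), div_self (hden _ _ _).ne']
    have hr1 : A₂ * v ≤ B₂ * u := by
      refine le_of_tendsto_of_tendsto (hv.const_mul A₂) (hu.const_mul B₂) ?_
      filter_upwards [hev] with N hN
      rw [← mul_div_assoc, ← mul_div_assoc]
      exact div_le_div_of_nonneg_right hN (hden _ _ _).le
    have hr2 : B₁ * u ≤ A₁ * v := by
      refine le_of_tendsto_of_tendsto (hu'.const_mul B₁) (hv'.const_mul A₁) ?_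
      filter_upwards [hev'] with N hN
      rw [← mul_div_assoc, ← mul_div_assoc]
      exact div_le_div_of_nonneg_right hN (hden _ _ _).le
    linarith [add_nonpos_of_separated hB₁ hB₂ hA₁ hAB hr1 hr2]

/-- The bad empirical measures of the time-evolved mean-field soft-core
Widom-Rowlinson model (with any symmetric a priori measure `α`) are exactly the
probability vectors `ν` whose occupied-site magnetization
`(ν(1) - ν(-1))/(ν(1) + ν(-1))` is a bad magnetization for the time-evolved
Curie-Weiss Ising model at inverse temperature `β(ν(1) + ν(-1))/2`. In particular
the set of bad empirical measures does not depend on the symmetric `α`. -/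
theorem wr_bad_measures_are_ising_bad_magnetizations (β t : ℝ) (hβ : 0 < β)
    (ht : 0 < t) (α : ℤ → ℝ) (hα : IsProbVec α) (hsym : α 1 = α (-1))
    (h1 : 0 < α 1) (h0 : 0 < α 0) (ν : ℤ → ℝ) (hν : IsProbVec ν) :
    IsBadMeasure β α t ν ↔
      (0 < ν 1 + ν (-1) ∧
        IsBadMagnetization (β * (ν 1 + ν (-1)) / 2) t
          ((ν 1 - ν (-1)) / (ν 1 + ν (-1)))) := by
  have hs : 0 ≤ ν 1 + ν (-1) := add_nonneg (hν.1 1) (hν.1 (-1))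
  rw [isBadMeasure_iff hβ ht hsym h1 h0 hν]
  rcases hs.eq_or_lt with h | hpos
  · have hz1 : ν 1 = 0 := by linarith [hν.1 1, hν.1 (-1)]
    have hz2 : ν (-1) = 0 := by linarith [hν.1 1, hν.1 (-1)]
    rw [hz1, hz2]
    simp [uniqueGlobalMax_fieldRate_zero_right (flipProb_pos ht) (flipProb_lt_stayProb t)
      (inv_pos.2 hβ) le_rfl]
  · set s := ν 1 + ν (-1) with hsdef
    have hI := isBadMagnetization_iff (βI := β * s / 2) (by positivity) ht
      (div_nonneg (hν.1 1) hs) (div_nonneg (hν.1 (-1)) hs)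
      (by rw [← add_div, ← hsdef, div_self hpos.ne'])
    rw [← sub_div] at hI
    have hscale := uniqueGlobalMax_fieldRate_smul_iff (stayProb t) (flipProb t)
      (1 / (2 * (β * s / 2))) (ν 1 / s) (ν (-1) / s) hpos
    rw [mul_div_cancel₀ _ hpos.ne', mul_div_cancel₀ _ hpos.ne',
      show s * (1 / (2 * (β * s / 2))) = 1 / β by field_simp] at hscale
    rw [hI, ← hscale]
    exact ⟨fun h => ⟨hpos, h⟩, fun h => h.2⟩
end

section
/- For every initial inverse temperature β_I > 0 and every time t > 0, the set B^{Ising}(β_I, t) of bad magnetizations of the time-evolved Curie-Weiss Ising model under rate-one independent symmetric spin-flip dynamics is either empty, or equal to {0}, or equal to a symmetric pair {−m_b, m_b} for some m_b > 0. -/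
open Real Filter Finset Topology

/-- For `s = ±1` and `a = e^{-2t}`, the tilted one-site partition sum `∑ σ, e^{xσ} p_t(σ, s)`. -/
noncomputable def siteFactor (a x s : ℝ) : ℝ := Real.cosh x + s * (a * Real.sinh x)

/-- The even part in `x` of `log (cosh x + a sinh x)`. -/
noncomputable def tiltEven (a x : ℝ) : ℝ :=
  (Real.log (siteFactor a x 1) + Real.log (siteFactor a x (-1))) / 2

/-- The odd part in `x` of `log (cosh x + a sinh x)`. -/
noncomputable def tiltOdd (a x : ℝ) : ℝ :=
  (Real.log (siteFactor a x 1) - Real.log (siteFactor a x (-1))) / 2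

/-- The exponent of the Hubbard-Stratonovich representation at final magnetization `m`. -/
noncomputable def freeEnergy (β a m x : ℝ) : ℝ :=
  -x ^ 2 / (2 * β) + tiltEven a x + m * tiltOdd a x

/-- The critical points of `freeEnergy β a m` are the solutions of `critFun β a x = m * a`. -/
noncomputable def critFun (β a x : ℝ) : ℝ :=
  x / β * (Real.cosh x ^ 2 - a ^ 2 * Real.sinh x ^ 2) -
    (1 - a ^ 2) * (Real.sinh x * Real.cosh x)

/-- The derivative of `critFun`. -/
noncomputable def critFunDeriv (β a x : ℝ) : ℝ :=
  1 / β * (Real.cosh x ^ 2 - a ^ 2 * Real.sinh x ^ 2) +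
    x / β * (2 * (1 - a ^ 2) * (Real.sinh x * Real.cosh x)) -
    (1 - a ^ 2) * (Real.cosh x ^ 2 + Real.sinh x ^ 2)

lemma siteFactor_pos {a x s : ℝ} (h0 : 0 < a) (h1 : a < 1) (hs : s = 1 ∨ s = -1) :
    0 < siteFactor a x s := by
  have h2 := Real.sinh_lt_cosh x
  have h3 := Real.sinh_lt_cosh (-x)
  rw [Real.sinh_neg, Real.cosh_neg] at h3
  unfold siteFactor
  rcases hs with rfl | rfl <;> nlinarith

lemma siteFactor_neg (a x s : ℝ) : siteFactor a (-x) s = siteFactor a x (-s) := by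
  simp [siteFactor]

lemma freeEnergy_neg (β a m x : ℝ) : freeEnergy β a (-m) (-x) = freeEnergy β a m x := by
  simp only [freeEnergy, tiltEven, tiltOdd, siteFactor_neg, neg_neg]
  ring

lemma hasDerivAt_siteFactor (a x s : ℝ) :
    HasDerivAt (fun y => siteFactor a y s) (Real.sinh x + s * (a * Real.cosh x)) x := by
  exact (Real.hasDerivAt_cosh x).add (((Real.hasDerivAt_sinh x).const_mul a).const_mul s)

lemma hasDerivAt_log_siteFactor {a s : ℝ} (h0 : 0 < a) (h1 : a < 1) (hs : s = 1 ∨ s = -1)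
    (x : ℝ) : HasDerivAt (fun y => Real.log (siteFactor a y s))
      ((Real.sinh x + s * (a * Real.cosh x)) / siteFactor a x s) x :=
  (hasDerivAt_siteFactor a x s).log (siteFactor_pos h0 h1 hs).ne'

lemma hasDerivAt_tiltOdd {a : ℝ} (h0 : 0 < a) (h1 : a < 1) (x : ℝ) :
    HasDerivAt (tiltOdd a) (a / (siteFactor a x 1 * siteFactor a x (-1))) x := by
  have h := ((hasDerivAt_log_siteFactor h0 h1 (Or.inl rfl) x).sub
    (hasDerivAt_log_siteFactor h0 h1 (Or.inr rfl) x)).div_const 2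
  refine h.congr_deriv ?_
  have hp := siteFactor_pos (x := x) h0 h1 (Or.inl rfl)
  have hm := siteFactor_pos (x := x) h0 h1 (Or.inr rfl)
  field_simp
  unfold siteFactor
  linear_combination (2 * a) * Real.cosh_sq x

lemma strictMono_tiltOdd {a : ℝ} (h0 : 0 < a) (h1 : a < 1) : StrictMono (tiltOdd a) := by
  refine strictMono_of_deriv_pos fun x => ?_
  rw [(hasDerivAt_tiltOdd h0 h1 x).deriv]
  exact div_pos h0 (mul_pos (siteFactor_pos h0 h1 (Or.inl rfl)) (siteFactor_pos h0 h1 (Or.inr rfl)))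

lemma hasDerivAt_freeEnergy {β a : ℝ} (hβ : 0 < β) (h0 : 0 < a) (h1 : a < 1) (m x : ℝ) :
    HasDerivAt (freeEnergy β a m)
      ((m * a - critFun β a x) / (siteFactor a x 1 * siteFactor a x (-1))) x := by
  have h := ((((hasDerivAt_pow 2 x).neg).div_const (2 * β)).add
    (((hasDerivAt_log_siteFactor h0 h1 (Or.inl rfl) x).add
    (hasDerivAt_log_siteFactor h0 h1 (Or.inr rfl) x)).div_const 2)).add
    ((hasDerivAt_tiltOdd h0 h1 x).const_mul m)
  refine h.congr_deriv ?_
  have hp := siteFactor_pos (x := x) h0 h1 (Or.inl rfl)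
  have hm := siteFactor_pos (x := x) h0 h1 (Or.inr rfl)
  unfold critFun
  field_simp
  unfold siteFactor
  push_cast
  ring

lemma continuous_freeEnergy {β a : ℝ} (hβ : 0 < β) (h0 : 0 < a) (h1 : a < 1) (m : ℝ) :
    Continuous (freeEnergy β a m) :=
  continuous_iff_continuousAt.2 fun x => (hasDerivAt_freeEnergy hβ h0 h1 m x).continuousAt

lemma critFun_eq_of_forall_le {β a m x : ℝ} (hβ : 0 < β) (h0 : 0 < a) (h1 : a < 1)
    (hx : ∀ y, freeEnergy β a m y ≤ freeEnergy β a m x) : critFun β a x = m * a := by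
  have hmax : IsLocalMax (freeEnergy β a m) x := Filter.Eventually.of_forall hx
  have h := hmax.hasDerivAt_eq_zero (hasDerivAt_freeEnergy hβ h0 h1 m x)
  have hp := siteFactor_pos (x := x) h0 h1 (Or.inl rfl)
  have hm := siteFactor_pos (x := x) h0 h1 (Or.inr rfl)
  rcases div_eq_zero_iff.1 h with h | h
  · linarith
  · exact absurd h (mul_pos hp hm).ne'

lemma maximizer_mono {β a m m' x x' : ℝ} (h0 : 0 < a) (h1 : a < 1) (hm : m < m')
    (hx : ∀ y, freeEnergy β a m y ≤ freeEnergy β a m x)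
    (hx' : ∀ y, freeEnergy β a m' y ≤ freeEnergy β a m' x') : x ≤ x' := by
  refine (strictMono_tiltOdd h0 h1).le_iff_le.1 ?_
  have e1 := hx x'
  have e2 := hx' x
  simp only [freeEnergy] at e1 e2
  nlinarith

lemma hasDerivAt_critFun (β a x : ℝ) :
    HasDerivAt (critFun β a) (critFunDeriv β a x) x := by
  have h := (((hasDerivAt_id x).div_const β).mul (((Real.hasDerivAt_cosh x).pow 2).sub
    (((Real.hasDerivAt_sinh x).pow 2).const_mul (a ^ 2)))).sub
    (((Real.hasDerivAt_sinh x).mul (Real.hasDerivAt_cosh x)).const_mul (1 - a ^ 2))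
  refine h.congr_deriv ?_
  simp [critFunDeriv]
  ring

lemma hasDerivAt_critFunDeriv {β : ℝ} (hβ : 0 < β) (a x : ℝ) :
    HasDerivAt (critFunDeriv β a) ((1 - a ^ 2) / β *
      (2 * x * Real.cosh (2 * x) - (2 * β - 2) * Real.sinh (2 * x))) x := by
  have hc := Real.hasDerivAt_cosh x
  have hs := Real.hasDerivAt_sinh x
  have h := ((((hc.pow 2).sub ((hs.pow 2).const_mul (a ^ 2))).const_mul (1 / β)).add
    (((hasDerivAt_id x).div_const β).mul ((hs.mul hc).const_mul (2 * (1 - a ^ 2))))).sub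
    (((hc.pow 2).add (hs.pow 2)).const_mul (1 - a ^ 2))
  refine h.congr_deriv ?_
  rw [Real.cosh_two_mul, Real.sinh_two_mul]
  simp
  field_simp
  ring

lemma id_mul_coth_mono {x y : ℝ} (hx : 0 < x) (hxy : x ≤ y) :
    x * Real.cosh x * Real.sinh y ≤ y * Real.cosh y * Real.sinh x := by
  have hmono : MonotoneOn (fun u => u * Real.cosh u / Real.sinh u) (Set.Ioi 0) := by
    have hd : ∀ u ∈ Set.Ioi (0 : ℝ), HasDerivAt (fun u => u * Real.cosh u / Real.sinh u)
        (((1 * Real.cosh u + u * Real.sinh u) * Real.sinh u - u * Real.cosh u * Real.cosh u)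
          / Real.sinh u ^ 2) u := fun u hu =>
      ((hasDerivAt_id u).mul (Real.hasDerivAt_cosh u)).div (Real.hasDerivAt_sinh u)
        (Real.sinh_pos_iff.2 hu).ne'
    refine monotoneOn_of_deriv_nonneg (convex_Ioi 0)
      (fun u hu => (hd u hu).continuousAt.continuousWithinAt)
      (fun u hu => ((hd u (interior_subset hu)).differentiableAt).differentiableWithinAt) ?_
    intro u hu
    have hu0 : 0 < u := interior_subset hu
    rw [(hd u hu0).deriv]
    refine div_nonneg ?_ (sq_nonneg _)
    have e1 := Real.cosh_sq u
    have e2 := Real.self_le_sinh_iff.2 hu0.le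
    have e3 := Real.one_le_cosh u
    nlinarith
  have h := hmono (Set.mem_Ioi.2 hx) (Set.mem_Ioi.2 (hx.trans_le hxy)) hxy
  exact (div_le_div_iff₀ (Real.sinh_pos_iff.2 hx) (Real.sinh_pos_iff.2 (hx.trans_le hxy))).1 h

/-- On the positive half-line `critFunDeriv` cannot rise strictly above a zero and come back. -/
lemma critFunDeriv_nonpos_of_between {β a p q r : ℝ} (hβ : 0 < β) (h0 : 0 < a) (h1 : a < 1)
    (hp : 0 < p) (hpq : p < q) (hqr : q < r)
    (hp0 : critFunDeriv β a p = 0) (hr0 : critFunDeriv β a r = 0) :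
    critFunDeriv β a q ≤ 0 := by
  by_contra! hq
  have hcont : Continuous (critFunDeriv β a) :=
    continuous_iff_continuousAt.2 fun x => (hasDerivAt_critFunDeriv hβ a x).continuousAt
  obtain ⟨u, hu, hu'⟩ := exists_hasDerivAt_eq_slope _ _ hpq hcont.continuousOn
    fun x _ => hasDerivAt_critFunDeriv hβ a x
  obtain ⟨v, hv, hv'⟩ := exists_hasDerivAt_eq_slope _ _ hqr hcont.continuousOn
    fun x _ => hasDerivAt_critFunDeriv hβ a x
  have hk : 0 < (1 - a ^ 2) / β := div_pos (by nlinarith) hβ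
  have hu1 : 0 < (1 - a ^ 2) / β *
      (2 * u * Real.cosh (2 * u) - (2 * β - 2) * Real.sinh (2 * u)) := by
    rw [hu', hp0]; exact div_pos (by linarith) (by linarith)
  have hv1 : (1 - a ^ 2) / β *
      (2 * v * Real.cosh (2 * v) - (2 * β - 2) * Real.sinh (2 * v)) < 0 := by
    rw [hv', hr0]; exact div_neg_of_neg_of_pos (by linarith) (by linarith)
  have hu2 := pos_of_mul_pos_right hu1 hk.le
  have hv2 := neg_of_mul_neg_right hv1 hk.le
  have hu0 : 0 < 2 * u := by linarith [hu.1]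
  have huv : 2 * u ≤ 2 * v := by linarith [hu.2, hv.1]
  have hm := id_mul_coth_mono hu0 huv
  have su := Real.sinh_pos_iff.2 hu0
  have sv := Real.sinh_pos_iff.2 (hu0.trans_le huv)
  nlinarith [mul_pos hu2 sv, mul_pos_of_neg_of_neg hv2 (neg_neg_of_pos su)]

lemma exists_critFunDeriv_eq_zero {β a v w : ℝ} (hvw : v < w)
    (h : critFun β a v = critFun β a w) : ∃ p ∈ Set.Ioo v w, critFunDeriv β a p = 0 :=
  exists_hasDerivAt_eq_zero hvw
    (fun x _ => (hasDerivAt_critFun β a x).continuousAt.continuousWithinAt) h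
    fun x _ => hasDerivAt_critFun β a x

/-- The free energy at magnetization `m` has at least two global maximizers. -/
def HasTwoMaximizers (β a m : ℝ) : Prop :=
  ∃ x y, x < y ∧ (∀ z, freeEnergy β a m z ≤ freeEnergy β a m x) ∧
    ∀ z, freeEnergy β a m z ≤ freeEnergy β a m y

/-- At most one nonnegative magnetization admits several global maximizers. -/
lemma not_two_levels {β a m m' : ℝ} (hβ : 0 < β) (h0 : 0 < a) (h1 : a < 1)
    (hm : 0 ≤ m) (hmm : m < m') (h : HasTwoMaximizers β a m) (h' : HasTwoMaximizers β a m') :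
    False := by
  obtain ⟨v', w', hvw', hv', hw'⟩ := h'
  have hnonneg : ∀ k x, 0 < k → (∀ z, freeEnergy β a k z ≤ freeEnergy β a k x) → 0 ≤ x := by
    intro k x hk hx
    have hx' : ∀ z, freeEnergy β a (-k) z ≤ freeEnergy β a (-k) (-x) := by
      intro z
      have := hx (-z)
      rwa [← freeEnergy_neg, neg_neg, ← freeEnergy_neg β a k x] at this
    have := maximizer_mono h0 h1 (by linarith : -k < k) hx' hx
    linarith
  obtain ⟨v, w, hv, hvw, hFv, hw⟩ : ∃ v w, 0 ≤ v ∧ v < w ∧ critFun β a v = m * a ∧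
      ∀ z, freeEnergy β a m z ≤ freeEnergy β a m w := by
    obtain ⟨x, y, hxy, hx, hy⟩ := h
    rcases hm.eq_or_lt with rfl | hm
    · have hF0 : critFun β a 0 = 0 * a := by simp [critFun]
      rcases lt_or_ge 0 y with h | h
      · exact ⟨0, y, le_rfl, h, hF0, hy⟩
      · refine ⟨0, -x, le_rfl, by linarith, hF0, fun z => ?_⟩
        have := hx (-z)
        rwa [← freeEnergy_neg, neg_neg, ← freeEnergy_neg β a 0 x, neg_zero] at this
    · exact ⟨x, y, hnonneg m x hm hx, hxy, critFun_eq_of_forall_le hβ h0 h1 hx, hy⟩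
  have hFw := critFun_eq_of_forall_le hβ h0 h1 hw
  have hFv' := critFun_eq_of_forall_le hβ h0 h1 hv'
  have hFw' := critFun_eq_of_forall_le hβ h0 h1 hw'
  have hlt : m * a < m' * a := by gcongr
  have hwv : w < v' := by
    refine lt_of_le_of_ne (maximizer_mono h0 h1 hmm hw hv') ?_
    rintro rfl
    linarith
  obtain ⟨p, hp, hp0⟩ := exists_critFunDeriv_eq_zero hvw (hFv.trans hFw.symm)
  obtain ⟨r, hr, hr0⟩ := exists_critFunDeriv_eq_zero hvw' (hFv'.trans hFw'.symm)
  obtain ⟨q, hq, hq'⟩ := exists_hasDerivAt_eq_slope (critFun β a) _ hwv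
    (fun x _ => (hasDerivAt_critFun β a x).continuousAt.continuousWithinAt)
    fun x _ => hasDerivAt_critFun β a x
  have hqpos : 0 < critFunDeriv β a q := by
    rw [hq', hFw, hFv']; exact div_pos (by linarith) (by linarith)
  exact absurd (critFunDeriv_nonpos_of_between hβ h0 h1 (hv.trans_lt hp.1)
    (hp.2.trans hq.1) (hq.2.trans hr.1) hp0 hr0) (not_le.2 hqpos)

open MeasureTheory ProbabilityTheory

lemma abs_tiltOdd_le {a : ℝ} (h0 : 0 < a) (h1 : a < 1) (x : ℝ) :
    |tiltOdd a x| ≤ (Real.log (1 + a) - Real.log (1 - a)) / 2 := by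
  have hp := siteFactor_pos (x := x) h0 h1 (Or.inl rfl)
  have hm := siteFactor_pos (x := x) h0 h1 (Or.inr rfl)
  have h2 := Real.sinh_lt_cosh x
  have h3 := Real.sinh_lt_cosh (-x)
  rw [Real.sinh_neg, Real.cosh_neg] at h3
  have h4 : (1 - a) * siteFactor a x 1 ≤ (1 + a) * siteFactor a x (-1) := by
    unfold siteFactor; nlinarith
  have h5 : (1 - a) * siteFactor a x (-1) ≤ (1 + a) * siteFactor a x 1 := by
    unfold siteFactor; nlinarith
  have ha : 0 < 1 - a := by linarith
  have hb : 0 < 1 + a := by linarith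
  have h6 := Real.log_le_log (by positivity) h4
  have h7 := Real.log_le_log (by positivity) h5
  rw [Real.log_mul ha.ne' hp.ne', Real.log_mul hb.ne' hm.ne'] at h6
  rw [Real.log_mul ha.ne' hm.ne', Real.log_mul hb.ne' hp.ne'] at h7
  rw [tiltOdd, abs_le]
  constructor <;> linarith

lemma log_siteFactor_le {a s : ℝ} (h0 : 0 < a) (h1 : a < 1) (hs : s = 1 ∨ s = -1) (x : ℝ) :
    Real.log (siteFactor a x s) ≤ |x| := by
  rw [Real.log_le_iff_le_exp (siteFactor_pos h0 h1 hs), ← Real.cosh_add_sinh |x|,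
    Real.cosh_abs, siteFactor]
  gcongr
  rcases abs_cases x with ⟨h, hx⟩ | ⟨h, hx⟩ <;> rw [h]
  · have := Real.sinh_nonneg_iff.2 hx
    rcases hs with rfl | rfl <;> nlinarith
  · have := Real.sinh_neg_iff.2 hx
    rw [Real.sinh_neg]
    rcases hs with rfl | rfl <;> nlinarith

lemma tendsto_freeEnergy_cocompact {β a m : ℝ} (hβ : 0 < β) (h0 : 0 < a) (h1 : a < 1) :
    Tendsto (freeEnergy β a m) (cocompact ℝ) atBot := by
  set K := |m| * ((Real.log (1 + a) - Real.log (1 - a)) / 2) with hK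
  have hquad : Tendsto (fun r : ℝ => r * (1 - r / (2 * β)) + K) atTop atBot := by
    refine tendsto_atBot_add_const_right _ _ (tendsto_id.atTop_mul_atBot₀ ?_)
    have : Tendsto (fun r : ℝ => 1 + -(r / (2 * β))) atTop atBot :=
      tendsto_atBot_add_const_left _ _
        (tendsto_neg_atTop_atBot.comp (tendsto_id.atTop_div_const (by positivity)))
    simpa [sub_eq_add_neg] using this
  refine tendsto_atBot_mono (fun x => ?_) (hquad.comp (tendsto_norm_cocompact_atTop (E := ℝ)))
  have e1 := log_siteFactor_le h0 h1 (Or.inl rfl) x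
  have e2 := log_siteFactor_le h0 h1 (Or.inr rfl) x
  have e3 : m * tiltOdd a x ≤ K := by
    refine (le_abs_self _).trans ?_
    rw [abs_mul, hK]
    exact mul_le_mul_of_nonneg_left (abs_tiltOdd_le h0 h1 x) (abs_nonneg m)
  have e4 : |x| * (1 - |x| / (2 * β)) = |x| - x ^ 2 / (2 * β) := by
    rw [← sq_abs x]; ring
  simp only [Function.comp, Real.norm_eq_abs, freeEnergy, tiltEven, e4, neg_div]
  linarith

lemma exists_gap_of_unique_max {f : ℝ → ℝ} (hf : Continuous f)
    (hlim : Tendsto f (cocompact ℝ) atBot) {x₀ : ℝ} (hx₀ : ∀ y, y ≠ x₀ → f y < f x₀)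
    {u : Set ℝ} (hu : IsOpen u) (hxu : x₀ ∈ u) :
    ∃ ε > 0, ∀ y ∉ u, f y ≤ f x₀ - ε := by
  rcases (uᶜ).eq_empty_or_nonempty with he | ⟨z, hz⟩
  · exact ⟨1, one_pos, fun y hy => absurd (he ▸ hy : y ∈ (∅ : Set ℝ)) (Set.notMem_empty y)⟩
  · obtain ⟨w, hw, hmax⟩ := hf.continuousOn.exists_isMaxOn' hu.isClosed_compl hz
      ((hlim.eventually_le_atBot (f z)).filter_mono inf_le_left)
    have hne : w ≠ x₀ := fun h => hw (h ▸ hxu)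
    exact ⟨f x₀ - f w, sub_pos.2 (hx₀ w hne), fun y hy => by linarith [isMaxOn_iff.1 hmax y hy]⟩

/-- Laplace principle for a uniformly convergent sequence of exponents whose limit has a unique,
well separated maximum. -/
lemma tendsto_integral_laplace {μ : Measure ℝ} [IsFiniteMeasure μ] [μ.IsOpenPosMeasure]
    {H : ℕ → ℝ → ℝ} {h g : ℝ → ℝ} {x₀ : ℝ} (hH : ∀ n, Continuous (H n)) (hh : Continuous h)
    (hunif : ∀ ε > 0, ∀ᶠ n in atTop, ∀ x, |H n x - h x| ≤ ε)
    (hgap : ∀ u : Set ℝ, IsOpen u → x₀ ∈ u → ∃ ε > 0, ∀ y ∉ u, h y ≤ h x₀ - ε)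
    (hbdd : ∀ n, ∃ C, ∀ x, H n x ≤ C)
    (hg : Integrable g μ) (hgc : Continuous g) :
    Tendsto (fun n : ℕ => (∫ x, Real.exp (n * H n x) * g x ∂μ) / ∫ x, Real.exp (n * H n x) ∂μ)
      atTop (𝓝 (g x₀)) := by
  have hint : ∀ n : ℕ, Integrable (fun x => Real.exp (n * H n x)) μ := by
    intro n
    obtain ⟨C, hC⟩ := hbdd n
    have := hH n
    refine Integrable.of_bound (by fun_prop) (Real.exp (n * C)) (ae_of_all _ fun x => ?_)
    rw [Real.norm_of_nonneg (Real.exp_pos _).le]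
    gcongr
    exact hC x
  have hZ : ∀ n : ℕ, 0 < ∫ x, Real.exp (n * H n x) ∂μ := by
    intro n
    have hμ : NeZero μ := ⟨fun h0 => by
      have := isOpen_univ.measure_pos μ (Set.univ_nonempty)
      simp [h0] at this⟩
    exact integral_exp_pos (hint n)
  have hmain := tendsto_setIntegral_peak_smul_of_integrableOn_of_tendsto
    (φ := fun (n : ℕ) x => Real.exp (n * H n x) / ∫ x, Real.exp (n * H n x) ∂μ)
    (l := atTop) (s := Set.univ) (t := Set.univ) (μ := μ) (x₀ := x₀) (g := g) (a := g x₀)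
    MeasurableSet.univ MeasurableSet.univ (Set.subset_univ _) (by simp) (measure_ne_top _ _)
    (Eventually.of_forall fun n x _ => div_nonneg (Real.exp_pos _).le (hZ n).le) ?_ ?_ ?_
    hg.integrableOn (hgc.continuousAt.tendsto.mono_left inf_le_left)
  · simp only [Measure.restrict_univ, smul_eq_mul] at hmain
    refine hmain.congr fun n => ?_
    rw [← integral_div]
    congr 1
    ext x
    ring
  · intro u hu hxu
    obtain ⟨ε, hε, hgap'⟩ := hgap u hu hxu
    set V := {x | h x₀ - ε / 4 < h x} with hV
    have hVo : IsOpen V := isOpen_lt continuous_const hh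
    have hVpos : 0 < μ.real V :=
      ENNReal.toReal_pos (hVo.measure_pos μ ⟨x₀, by simp [hV, hε]⟩).ne' (measure_ne_top _ _)
    have hbound : ∀ᶠ n : ℕ in atTop, ∀ x ∈ Set.univ \ u,
        Real.exp (n * H n x) / ∫ x, Real.exp (n * H n x) ∂μ
          ≤ Real.exp (-(n * (ε / 4))) / μ.real V := by
      filter_upwards [hunif (ε / 4) (by positivity)] with n hn x hx
      have hlow : μ.real V * Real.exp (n * (h x₀ - ε / 2)) ≤ ∫ x, Real.exp (n * H n x) ∂μ := by
        calc μ.real V * Real.exp (n * (h x₀ - ε / 2))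
            = ∫ _ in V, Real.exp (n * (h x₀ - ε / 2)) ∂μ := by simp [Measure.real]
          _ ≤ ∫ x in V, Real.exp (n * H n x) ∂μ := by
            refine setIntegral_mono_on (integrable_const _) (hint n).integrableOn
              hVo.measurableSet fun y hy => ?_
            have := (abs_le.1 (hn y)).1
            have hy' : h x₀ - ε / 4 < h y := hy
            gcongr
            linarith
          _ ≤ ∫ x, Real.exp (n * H n x) ∂μ :=
            setIntegral_le_integral (hint n) (ae_of_all _ fun _ => (Real.exp_pos _).le)
      have hup : Real.exp (n * H n x) ≤
          Real.exp (-(n * (ε / 4))) * Real.exp (n * (h x₀ - ε / 2)) := by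
        rw [← Real.exp_add]
        have := (abs_le.1 (hn x)).2
        have h2 := hgap' x hx.2
        have h3 : H n x ≤ -(ε / 4) + (h x₀ - ε / 2) := by linarith
        refine Real.exp_le_exp.2 ?_
        nlinarith [mul_le_mul_of_nonneg_left h3 (Nat.cast_nonneg (α := ℝ) n)]
      rw [div_le_div_iff₀ (hZ n) hVpos]
      calc _ ≤ Real.exp (-(n * (ε / 4))) * Real.exp (n * (h x₀ - ε / 2)) * μ.real V := by gcongr
        _ = Real.exp (-(n * (ε / 4))) * (μ.real V * Real.exp (n * (h x₀ - ε / 2))) := by ring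
        _ ≤ _ := by gcongr
    have hlim : Tendsto (fun n : ℕ => Real.exp (-(n * (ε / 4))) / μ.real V) atTop (𝓝 0) := by
      rw [← zero_div (μ.real V)]
      refine (Real.tendsto_exp_neg_atTop_nhds_zero.comp ?_).div_const _
      exact tendsto_natCast_atTop_atTop.atTop_mul_const (by positivity)
    rw [Metric.tendstoUniformlyOn_iff]
    intro δ hδ
    filter_upwards [hbound, hlim.eventually_lt_const hδ] with n hn hn' x hx
    rw [Pi.zero_apply, dist_comm, dist_zero_right,
      Real.norm_of_nonneg (div_nonneg (Real.exp_pos _).le (hZ n).le)]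
    exact (hn x hx).trans_lt hn'
  · simp only [Measure.restrict_univ, integral_div]
    exact tendsto_const_nhds.congr fun n => (div_self (hZ n).ne').symm
  · refine Eventually.of_forall fun n => ?_
    have := hH n
    exact Continuous.aestronglyMeasurable (by fun_prop)

lemma ISpin.coe_eq (s : ISpin) : ((s : ℤ) : ℝ) = 1 ∨ ((s : ℤ) : ℝ) = -1 := by
  obtain ⟨s, hs⟩ := s
  simp only [Finset.mem_insert, Finset.mem_singleton] at hs
  rcases hs with rfl | rfl <;> simp

lemma sum_ISpin (f : ℤ → ℝ) : ∑ s : ISpin, f s = f (-1) + f 1 := by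
  rw [Finset.sum_coe_sort ISpin f]
  exact Finset.sum_pair (by decide)

lemma sum_exp_mul_pFlip (t x : ℝ) (e : ISpin) :
    ∑ s : ISpin, Real.exp (((s : ℤ) : ℝ) * x) * pFlip t s e =
      siteFactor (Real.exp (-2 * t)) x ((e : ℤ) : ℝ) := by
  rw [sum_ISpin fun s => Real.exp ((s : ℝ) * x) * pFlip t s e]
  obtain ⟨e, he⟩ := e
  simp only [Finset.mem_insert, Finset.mem_singleton] at he
  rcases he with rfl | rfl <;>
    simp [pFlip, siteFactor, Real.cosh_eq, Real.sinh_eq] <;> ring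

lemma isingWeightT_eq_gaussian {β : ℝ} (hβ : 0 < β) (t : ℝ) {N : ℕ} (η : Fin N → ISpin) :
    isingWeightT β t η = (2 : ℝ) ^ (-(N : ℤ)) *
      ∫ x, ∏ i, siteFactor (Real.exp (-2 * t)) x ((η i : ℤ) : ℝ)
        ∂(gaussianReal 0 (β / N).toNNReal) := by
  have hmgf : ∀ S : ℝ, Real.exp (β / (2 * (N : ℝ)) * S ^ 2) =
      ∫ x, Real.exp (S * x) ∂(gaussianReal 0 (β / N).toNNReal) := by
    intro S
    have h := congrFun (mgf_fun_id_gaussianReal (μ := 0) (v := (β / N).toNNReal)) S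
    rw [mgf] at h
    rw [h, Real.coe_toNNReal _ (by positivity)]
    congr 1
    ring
  simp_rw [← sum_exp_mul_pFlip, Fintype.prod_sum, Finset.prod_mul_distrib, ← Real.exp_sum,
    ← Finset.sum_mul]
  rw [integral_finsetSum _ fun σ _ => (integrable_exp_mul_gaussianReal _).mul_const _,
    isingWeightT, Finset.mul_sum]
  refine Finset.sum_congr rfl fun σ _ => ?_
  rw [integral_mul_const, ← hmgf]
  ring

lemma integral_gaussianReal_div {β : ℝ} (hβ : 0 < β) (N : ℕ) (f : ℝ → ℝ) :
    ∫ x, f x ∂(gaussianReal 0 (β / ((N + 1 : ℕ) : ℝ)).toNNReal) =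
      √(N + 1) * ∫ x, Real.exp (N * (-x ^ 2 / (2 * β))) * f x ∂(gaussianReal 0 β.toNNReal) := by
  have hN : (0 : ℝ) < ((N + 1 : ℕ) : ℝ) := by positivity
  have hv : (β / ((N + 1 : ℕ) : ℝ)).toNNReal ≠ 0 := (Real.toNNReal_pos.2 (by positivity)).ne'
  have hv' : β.toNNReal ≠ 0 := (Real.toNNReal_pos.2 hβ).ne'
  rw [integral_gaussianReal_eq_integral_smul hv, integral_gaussianReal_eq_integral_smul hv',
    ← integral_const_mul]
  congr 1
  ext x
  rw [gaussianPDFReal, gaussianPDFReal, Real.coe_toNNReal _ (by positivity),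
    Real.coe_toNNReal _ hβ.le]
  have e1 : (√(2 * π * (β / ((N + 1 : ℕ) : ℝ))))⁻¹ = √(N + 1) * (√(2 * π * β))⁻¹ := by
    rw [← mul_div_assoc, Real.sqrt_div (by positivity)]
    push_cast
    rw [inv_div, div_eq_mul_inv]
  have e2 : Real.exp (-(x - 0) ^ 2 / (2 * (β / ((N + 1 : ℕ) : ℝ)))) =
      Real.exp (-(x - 0) ^ 2 / (2 * β)) * Real.exp (N * (-x ^ 2 / (2 * β))) := by
    rw [← Real.exp_add]
    congr 1
    push_cast
    field_simp
    ring
  rw [e1, e2, smul_eq_mul, smul_eq_mul]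
  ring

lemma prod_siteFactor {a : ℝ} (h0 : 0 < a) (h1 : a < 1) (x : ℝ) {N : ℕ} (τ : Fin N → ISpin) :
    ∏ i, siteFactor a x ((τ i : ℤ) : ℝ) =
      Real.exp (N * (tiltEven a x + (∑ i, ((τ i : ℤ) : ℝ)) / N * tiltOdd a x)) := by
  have hterm : ∀ s : ISpin, siteFactor a x ((s : ℤ) : ℝ) =
      Real.exp (tiltEven a x + ((s : ℤ) : ℝ) * tiltOdd a x) := by
    intro s
    rw [← Real.exp_log (siteFactor_pos h0 h1 (ISpin.coe_eq s))]
    congr 1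
    unfold tiltEven tiltOdd
    rcases ISpin.coe_eq s with h | h <;> rw [h] <;> ring
  simp_rw [hterm]
  rw [← Real.exp_sum, Finset.sum_add_distrib, ← Finset.sum_mul]
  congr 1
  rcases N.eq_zero_or_pos with rfl | hN
  · simp
  · simp
    field_simp

lemma isingWeightT_cons_s12 {β t : ℝ} (hβ : 0 < β) (ht : 0 < t) {N : ℕ} (s : ISpin)
    (τ : Fin N → ISpin) :
    isingWeightT β t (Fin.cons s τ : Fin (N + 1) → ISpin) =
      (2 : ℝ) ^ (-((N + 1 : ℕ) : ℤ)) * √(N + 1) *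
        ∫ x, Real.exp (N * freeEnergy β (Real.exp (-2 * t)) ((∑ i, ((τ i : ℤ) : ℝ)) / N) x) *
          siteFactor (Real.exp (-2 * t)) x ((s : ℤ) : ℝ) ∂(gaussianReal 0 β.toNNReal) := by
  rw [isingWeightT_eq_gaussian hβ, integral_gaussianReal_div hβ, mul_assoc]
  congr 3
  ext x
  rw [Fin.prod_univ_succ]
  simp only [Fin.cons_zero, Fin.cons_succ]
  rw [prod_siteFactor (Real.exp_pos _) (Real.exp_lt_one_iff.2 (by linarith)), mul_left_comm,
    ← Real.exp_add, mul_comm]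
  congr 2
  unfold freeEnergy
  ring

/-- If the free energy has a unique maximizer, the conditional probabilities converge. -/
lemma tendsto_isingCondProbT {β t m x₀ : ℝ} (hβ : 0 < β) (ht : 0 < t)
    (hx₀ : ∀ y, y ≠ x₀ →
      freeEnergy β (Real.exp (-2 * t)) m y < freeEnergy β (Real.exp (-2 * t)) m x₀)
    {τ : (N : ℕ) → Fin N → ISpin}
    (hτ : Tendsto (fun N : ℕ => (∑ i : Fin N, ((τ N i : ℤ) : ℝ)) / N) atTop (𝓝 m)) (s : ISpin) :
    Tendsto (fun N : ℕ => isingCondProbT β t s (τ N)) atTop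
      (𝓝 (siteFactor (Real.exp (-2 * t)) x₀ ((s : ℤ) : ℝ) /
        ∑ s' : ISpin, siteFactor (Real.exp (-2 * t)) x₀ ((s' : ℤ) : ℝ))) := by
  set a := Real.exp (-2 * t) with ha
  have h0 : 0 < a := Real.exp_pos _
  have h1 : a < 1 := Real.exp_lt_one_iff.2 (by linarith)
  set M : ℕ → ℝ := fun N : ℕ => (∑ i : Fin N, ((τ N i : ℤ) : ℝ)) / N with hM
  set γ := gaussianReal 0 β.toNNReal with hγ
  have hv : β.toNNReal ≠ 0 := (Real.toNNReal_pos.2 hβ).ne'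
  have : γ.IsOpenPosMeasure := (gaussianReal_absolutelyContinuous' 0 hv).isOpenPosMeasure
  set Z : ℕ → ℝ := fun N => ∫ x, Real.exp (N * freeEnergy β a (M N) x) ∂γ with hZ
  set W : ISpin → ℕ → ℝ := fun s N =>
    ∫ x, Real.exp (N * freeEnergy β a (M N) x) * siteFactor a x ((s : ℤ) : ℝ) ∂γ with hW
  have hlap : ∀ s : ISpin, Tendsto (fun N => W s N / Z N) atTop
      (𝓝 (siteFactor a x₀ ((s : ℤ) : ℝ))) := by
    intro s
    have hcoer := fun k => tendsto_freeEnergy_cocompact (m := k) hβ h0 h1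
    refine tendsto_integral_laplace (g := fun x => siteFactor a x ((s : ℤ) : ℝ))
      (fun n => continuous_freeEnergy hβ h0 h1 (M n))
      (continuous_freeEnergy hβ h0 h1 m) ?_ ?_ ?_ ?_ ?_
    · intro ε hε
      have hlim : Tendsto (fun n => |M n - m| * ((Real.log (1 + a) - Real.log (1 - a)) / 2))
          atTop (𝓝 0) := by
        have := ((hτ.sub_const m).abs).mul_const ((Real.log (1 + a) - Real.log (1 - a)) / 2)
        simpa using this
      filter_upwards [hlim.eventually_le_const hε] with n hn x
      have e : freeEnergy β a (M n) x - freeEnergy β a m x = (M n - m) * tiltOdd a x := by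
        unfold freeEnergy; ring
      rw [e, abs_mul]
      exact (mul_le_mul_of_nonneg_left (abs_tiltOdd_le h0 h1 x) (abs_nonneg _)).trans hn
    · intro u hu hxu
      exact exists_gap_of_unique_max (continuous_freeEnergy hβ h0 h1 m) (hcoer m) hx₀ hu hxu
    · intro n
      obtain ⟨y, hy⟩ := (continuous_freeEnergy hβ h0 h1 (M n)).exists_forall_ge (hcoer (M n))
      exact ⟨_, hy⟩
    · have i1 := integrable_exp_mul_gaussianReal (μ := 0) (v := β.toNNReal) 1
      have i2 := integrable_exp_mul_gaussianReal (μ := 0) (v := β.toNNReal) (-1)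
      refine (((i1.add i2).div_const 2).add
        ((((i1.sub i2).div_const 2).const_mul a).const_mul ((s : ℤ) : ℝ))).congr
        (ae_of_all _ fun x => ?_)
      simp [siteFactor, Real.cosh_eq, Real.sinh_eq]
    · unfold siteFactor
      fun_prop
  have hpos : 0 < ∑ s' : ISpin, siteFactor a x₀ ((s' : ℤ) : ℝ) :=
    Finset.sum_pos (fun s _ => siteFactor_pos h0 h1 (ISpin.coe_eq s)) ⟨s, Finset.mem_univ s⟩
  refine ((hlap s).div (tendsto_finsetSum _ fun s' _ => hlap s') hpos.ne').congr' ?_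
  filter_upwards [(hlap s).eventually_ne (siteFactor_pos h0 h1 (ISpin.coe_eq s)).ne'] with N hN
  have hZpos : Z N ≠ 0 := (div_ne_zero_iff.1 hN).2
  simp only [Pi.div_apply, isingCondProbT, isingWeightT_cons_s12 hβ ht]
  rw [← Finset.mul_sum, ← Finset.sum_div]
  rw [div_div_div_cancel_right₀ hZpos, mul_div_mul_left _ _ (by positivity)]

/-- The spin flip on `{-1, 1}`. -/
def spinFlip : ISpin ≃ ISpin where
  toFun s := ⟨-s, by have := s.2; grind⟩
  invFun s := ⟨-s, by have := s.2; grind⟩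
  left_inv s := by simp
  right_inv s := by simp

lemma pFlip_neg (t : ℝ) (a b : ℤ) : pFlip t (-a) (-b) = pFlip t a b := by
  unfold pFlip
  have e : ∀ c d : ℤ, -c = d ↔ c = -d := fun c d => neg_eq_iff_eq_neg
  simp only [e, neg_neg, neg_zero]
  congr 1
  simp only [or_comm]

lemma isingWeightT_spinFlip (β t : ℝ) {N : ℕ} (η : Fin N → ISpin) :
    isingWeightT β t (fun i => spinFlip (η i)) = isingWeightT β t η := by
  unfold isingWeightT
  refine Fintype.sum_equiv (Equiv.arrowCongr (Equiv.refl _) spinFlip) _ _ fun σ => ?_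
  simp [spinFlip, Equiv.arrowCongr, Finset.sum_neg_distrib, ← pFlip_neg t (-_)]

lemma isingCondProbT_spinFlip (β t : ℝ) {N : ℕ} (s : ISpin) (τ : Fin N → ISpin) :
    isingCondProbT β t (spinFlip s) (fun i => spinFlip (τ i)) = isingCondProbT β t s τ := by
  have hcons : ∀ s', isingWeightT β t (Fin.cons (spinFlip s') fun i => spinFlip (τ i) :
      Fin (N + 1) → ISpin) = isingWeightT β t (Fin.cons s' τ : Fin (N + 1) → ISpin) := by
    intro s'
    rw [← isingWeightT_spinFlip β t (Fin.cons s' τ : Fin (N + 1) → ISpin)]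
    congr 1
    ext i
    refine Fin.cases ?_ (fun i => ?_) i <;> simp
  unfold isingCondProbT
  rw [hcons]
  congr 1
  rw [← spinFlip.sum_comp]
  exact Finset.sum_congr rfl fun s' _ => hcons s'

lemma IsBadMagnetization.neg {β t m : ℝ} (h : IsBadMagnetization β t m) :
    IsBadMagnetization β t (-m) := by
  obtain ⟨τ, τ', hτ, hτ', s, hs⟩ := h
  have hflip : ∀ ρ : (N : ℕ) → Fin N → ISpin,
      Tendsto (fun N : ℕ => (∑ i : Fin N, ((ρ N i : ℤ) : ℝ)) / N) atTop (𝓝 m) →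
      Tendsto (fun N : ℕ => (∑ i : Fin N, ((spinFlip (ρ N i) : ℤ) : ℝ)) / N) atTop (𝓝 (-m)) := by
    intro ρ hρ
    refine hρ.neg.congr fun N => ?_
    simp [spinFlip, Finset.sum_neg_distrib, neg_div]
  refine ⟨fun N i => spinFlip (τ N i), fun N i => spinFlip (τ' N i), hflip τ hτ, hflip τ' hτ',
    spinFlip s, ?_⟩
  simpa only [isingCondProbT_spinFlip] using hs

lemma IsBadMagnetization.hasTwoMaximizers {β t m : ℝ} (hβ : 0 < β) (ht : 0 < t)
    (h : IsBadMagnetization β t m) : HasTwoMaximizers β (Real.exp (-2 * t)) m := by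
  have h0 : 0 < Real.exp (-2 * t) := Real.exp_pos _
  have h1 : Real.exp (-2 * t) < 1 := Real.exp_lt_one_iff.2 (by linarith)
  obtain ⟨x, hx⟩ := (continuous_freeEnergy hβ h0 h1 m).exists_forall_ge
    (tendsto_freeEnergy_cocompact hβ h0 h1)
  by_contra hnot
  obtain ⟨τ, τ', hτ, hτ', s, hs⟩ := h
  have huniq : ∀ y, y ≠ x →
      freeEnergy β (Real.exp (-2 * t)) m y < freeEnergy β (Real.exp (-2 * t)) m x := by
    intro y hy
    by_contra! hle
    have hy' := fun z => (hx z).trans hle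
    rcases hy.lt_or_gt with hlt | hlt
    · exact hnot ⟨y, x, hlt, hy', hx⟩
    · exact hnot ⟨x, y, hlt, hx, hy'⟩
  exact hs ⟨_, tendsto_isingCondProbT hβ ht huniq hτ s, tendsto_isingCondProbT hβ ht huniq hτ' s⟩

lemma IsBadMagnetization.eq_of_nonneg {β t m m' : ℝ} (hβ : 0 < β) (ht : 0 < t)
    (hm : 0 ≤ m) (hm' : 0 ≤ m') (h : IsBadMagnetization β t m)
    (h' : IsBadMagnetization β t m') : m = m' := by
  have h0 : 0 < Real.exp (-2 * t) := Real.exp_pos _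
  have h1 : Real.exp (-2 * t) < 1 := Real.exp_lt_one_iff.2 (by linarith)
  rcases lt_trichotomy m m' with hlt | heq | hlt
  · exact (not_two_levels hβ h0 h1 hm hlt (h.hasTwoMaximizers hβ ht)
      (h'.hasTwoMaximizers hβ ht)).elim
  · exact heq
  · exact (not_two_levels hβ h0 h1 hm' hlt (h'.hasTwoMaximizers hβ ht)
      (h.hasTwoMaximizers hβ ht)).elim

/-- The set of bad magnetizations of the time-evolved Curie-Weiss Ising model is
either empty, or `{0}`, or a symmetric pair `{-m_b, m_b}` with `m_b > 0`. -/
theorem ising_bad_set_trichotomy (βI t : ℝ) (hβ : 0 < βI) (ht : 0 < t) :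
    (∀ m ∈ Set.Icc (-1 : ℝ) 1, ¬ IsBadMagnetization βI t m) ∨
    (∀ m ∈ Set.Icc (-1 : ℝ) 1, IsBadMagnetization βI t m ↔ m = 0) ∨
    (∃ mb : ℝ, 0 < mb ∧ ∀ m ∈ Set.Icc (-1 : ℝ) 1,
      IsBadMagnetization βI t m ↔ (m = -mb ∨ m = mb)) := by
  by_cases hex : ∃ m, 0 ≤ m ∧ IsBadMagnetization βI t m
  · obtain ⟨m₀, hm₀, hbad⟩ := hex
    have key : ∀ m, IsBadMagnetization βI t m ↔ m = -m₀ ∨ m = m₀ := by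
      refine fun m => ⟨fun hm => ?_, ?_⟩
      · rcases le_total 0 m with h | h
        · exact Or.inr (hm.eq_of_nonneg hβ ht h hm₀ hbad)
        · have := hm.neg.eq_of_nonneg hβ ht (neg_nonneg.2 h) hm₀ hbad
          exact Or.inl (by linarith)
      · rintro (rfl | rfl)
        exacts [hbad.neg, hbad]
    rcases hm₀.eq_or_lt with rfl | hpos
    · exact Or.inr (Or.inl fun m _ => by simpa using key m)
    · exact Or.inr (Or.inr ⟨m₀, hpos, fun m _ => key m⟩)
  · refine Or.inl fun m _ hm => hex ?_
    rcases le_total 0 m with h | h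
    · exact ⟨m, h, hm⟩
    · exact ⟨-m, neg_nonneg.2 h, hm.neg⟩
end
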